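/- arXiv:2411.13493 — 2 statements merged into one kernel-verified Lean document; each statement's English description precedes it below -/
import Mathlib

section
/- With the notation below, for all m ≥ 1 and 1 ≤ r ≤ m, H(W^{(m+1)}_{≤r} | W^{(m+1)}_{>r}) ≤ f_{m,≤r} + f_{m,≤r−1} − (1/140)·min( f_{m,r}, binom(m,r) − f_{m,r} ). -/
open MeasureTheory

/-- Index set: binary strings of length `m` (indexing both coordinates and monomials). -/
abbrev Idx (m : ℕ) := Fin m → ZMod 2

/-- Hamming weight of a binary string. -/
def wt {m : ℕ} (x : Idx m) : ℕ := (Finset.univ.filter (fun i => x i = 1)).card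

/-- The 2×2 base matrix `[[1,0],[1,1]]` (rows/columns indexed by `F₂`):
entry `(a,b)` is `0` iff `a = 0` and `b = 1`. -/
def base : ZMod 2 → ZMod 2 → ZMod 2 := fun a b => if a = 0 ∧ b = 1 then 0 else 1

/-- The `m`-fold Kronecker power `G = [[1,0],[1,1]]^{⊗ m}`, as a matrix indexed by
binary strings of length `m`. -/
def Gmat (m : ℕ) : Matrix (Idx m) (Idx m) (ZMod 2) := fun x y => ∏ i, base (x i) (y i)

/-- The Bernoulli(δ) measure on `F₂` (probability `δ` of `1`). -/
noncomputable def bern2 (δ : ℝ) : Measure (ZMod 2) :=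
  ENNReal.ofReal δ • Measure.dirac 1 + ENNReal.ofReal (1 - δ) • Measure.dirac 0

/-- The law of the i.i.d. Bernoulli(δ) noise vector `Z = (Z_x)_{x ∈ F₂^m}`. -/
noncomputable def noise (m : ℕ) (δ : ℝ) : Measure (Idx m → ZMod 2) :=
  Measure.pi (fun _ => bern2 δ)

/-- The transformed noise vector `W = G Z`. -/
def Wfun (m : ℕ) (z : Idx m → ZMod 2) : Idx m → ZMod 2 := (Gmat m).mulVec z

/-- `W_r`: the coordinates of `W` whose index has Hamming weight exactly `r`. -/
def Wr (m r : ℕ) (z : Idx m → ZMod 2) : {x : Idx m // wt x = r} → ZMod 2 :=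
  fun x => Wfun m z x.val

/-- `W_{>r}`: the coordinates of `W` whose index has Hamming weight `> r`. -/
def Wgt (m r : ℕ) (z : Idx m → ZMod 2) : {x : Idx m // r < wt x} → ZMod 2 :=
  fun x => Wfun m z x.val

/-- `W_{≤r}`: the coordinates of `W` whose index has Hamming weight `≤ r`. -/
def Wle (m r : ℕ) (z : Idx m → ZMod 2) : {x : Idx m // wt x ≤ r} → ZMod 2 :=
  fun x => Wfun m z x.val

/-- Base-2 Shannon entropy of a random variable `X` (with finitely many values)
on the probability space `(Ω, μ)`: `H(X) = -∑ₛ P(X = s) log₂ P(X = s)`. -/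
noncomputable def ent {Ω S : Type*} [MeasurableSpace Ω] (μ : Measure Ω) (X : Ω → S) : ℝ :=
  -∑' s : S, (μ (X ⁻¹' {s})).toReal * Real.logb 2 (μ (X ⁻¹' {s})).toReal

/-- Conditional entropy `H(X|Y) = H(X,Y) - H(Y)`. -/
noncomputable def condEnt {Ω S T : Type*} [MeasurableSpace Ω] (μ : Measure Ω)
    (X : Ω → S) (Y : Ω → T) : ℝ :=
  ent μ (fun ω => (X ω, Y ω)) - ent μ Y

namespace FinEntropy

section Law

variable {Ω Ω' R S T : Type*} [Fintype Ω] [Fintype Ω']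

open Classical in
/-- The law of `X` under the weight function `p`. -/
noncomputable def law (p : Ω → ℝ) (X : Ω → S) (s : S) : ℝ :=
  ∑ ω, if X ω = s then p ω else 0

/-- The Shannon entropy of `X` under the weight function `p`, in nats. -/
noncomputable def shEnt (p : Ω → ℝ) (X : Ω → S) : ℝ :=
  -∑ ω, p ω * Real.log (law p X (X ω))

/-- The product of two weight functions. -/
def prodW (p : Ω → ℝ) (q : Ω' → ℝ) (ω : Ω × Ω') : ℝ := p ω.1 * q ω.2

theorem sum_law_mul [Fintype S] (p : Ω → ℝ) (X : Ω → S) (h : S → ℝ) :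
    ∑ s, law p X s * h s = ∑ ω, p ω * h (X ω) := by
  classical
  simp only [law, Finset.sum_mul]
  rw [Finset.sum_comm]
  refine Finset.sum_congr rfl fun ω _ => ?_
  simp [ite_mul]

theorem law_eq_sum_mul (p : Ω → ℝ) (X : Ω → S) (s : S) [DecidableEq S] :
    law p X s = ∑ ω, p ω * if X ω = s then 1 else 0 := by
  unfold law
  refine Finset.sum_congr rfl fun ω _ => ?_
  split_ifs <;> simp

theorem law_law [Fintype S] (p : Ω → ℝ) (X : Ω → S) (g : S → T) :
    law (law p X) g = law p (fun ω => g (X ω)) := by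
  classical
  ext t
  rw [law_eq_sum_mul, law_eq_sum_mul, sum_law_mul p X (fun s => if g s = t then 1 else 0)]

theorem law_id (p : Ω → ℝ) : law p (fun ω => ω) = p := by
  classical
  ext ω
  simp [law]

theorem shEnt_law [Fintype S] (p : Ω → ℝ) (X : Ω → S) (g : S → T) :
    shEnt (law p X) g = shEnt p (fun ω => g (X ω)) := by
  unfold shEnt
  rw [law_law, sum_law_mul p X (fun s => Real.log (law p (fun ω => g (X ω)) (g s)))]

theorem shEnt_law_id [Fintype S] (p : Ω → ℝ) (X : Ω → S) :
    shEnt (law p X) (fun s => s) = shEnt p X := shEnt_law p X _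

theorem shEnt_id (p : Ω → ℝ) : shEnt p (fun ω => ω) = ∑ ω, Real.negMulLog (p ω) := by
  simp [shEnt, law_id, Real.negMulLog]

theorem shEnt_eq_sum_negMulLog [Fintype S] (p : Ω → ℝ) (X : Ω → S) :
    shEnt p X = ∑ s, Real.negMulLog (law p X s) := by
  rw [← shEnt_law_id, shEnt_id]

theorem law_nonneg {p : Ω → ℝ} (hp : ∀ ω, 0 ≤ p ω) (X : Ω → S) (s : S) : 0 ≤ law p X s := by
  classical
  exact Finset.sum_nonneg fun ω _ => by split_ifs <;> simp [hp]

theorem le_law {p : Ω → ℝ} (hp : ∀ ω, 0 ≤ p ω) (X : Ω → S) (ω : Ω) : p ω ≤ law p X (X ω) := by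
  classical
  have := Finset.single_le_sum (f := fun ω' => if X ω' = X ω then p ω' else 0)
    (fun ω' _ => by split_ifs <;> simp [hp]) (Finset.mem_univ ω)
  simpa [law] using this

theorem law_congr_event {p : Ω → ℝ} {X : Ω → S} {Y : Ω → T} {s : S} {t : T}
    (h : ∀ ω, p ω ≠ 0 → (X ω = s ↔ Y ω = t)) : law p X s = law p Y t := by
  classical
  refine Finset.sum_congr rfl fun ω _ => ?_
  by_cases h0 : p ω = 0
  · simp [h0]
  · simp [h ω h0]

theorem sum_law [Fintype S] (p : Ω → ℝ) (X : Ω → S) : ∑ s, law p X s = ∑ ω, p ω := by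
  simpa using sum_law_mul p X fun _ => 1

theorem law_mem_stdSimplex [Fintype S] {p : Ω → ℝ} (hp : p ∈ stdSimplex ℝ Ω) (X : Ω → S) :
    law p X ∈ stdSimplex ℝ S :=
  ⟨law_nonneg hp.1 X, by rw [sum_law, hp.2]⟩

/-- Entropy only depends on the partition of the support induced by the variable. -/
theorem shEnt_congr {p : Ω → ℝ} {X : Ω → S} {Y : Ω → T}
    (h : ∀ ω ω', p ω ≠ 0 → p ω' ≠ 0 → (X ω = X ω' ↔ Y ω = Y ω')) : shEnt p X = shEnt p Y := by
  unfold shEnt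
  congr 1
  refine Finset.sum_congr rfl fun ω _ => ?_
  by_cases h0 : p ω = 0
  · simp [h0]
  · rw [law_congr_event fun ω' h' => h ω' ω h' h0]

theorem shEnt_const {p : Ω → ℝ} (hp : ∑ ω, p ω = 1) (s : S) : shEnt p (fun _ => s) = 0 := by
  simp [shEnt, law, hp]

/-- Submodularity of entropy. -/
theorem shEnt_submodular {p : Ω → ℝ} (hp : ∀ ω, 0 ≤ p ω) {S₁ S₂ S₃ S₄ : Type*}
    {A : Ω → S₁} {B : Ω → S₂} {C : Ω → S₃} {D : Ω → S₄}
    (hD : ∀ ω ω', A ω = A ω' → B ω = B ω' → D ω = D ω')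
    (hA : ∀ ω ω', A ω = A ω' → C ω = C ω') (hB : ∀ ω ω', B ω = B ω' → C ω = C ω') :
    shEnt p D + shEnt p C ≤ shEnt p A + shEnt p B := by
  classical
  have posA : ∀ ω, p ω ≠ 0 → 0 < law p A (A ω) := fun ω h =>
    ((hp ω).lt_of_ne' h).trans_le (le_law hp A ω)
  have posB : ∀ ω, p ω ≠ 0 → 0 < law p B (B ω) := fun ω h =>
    ((hp ω).lt_of_ne' h).trans_le (le_law hp B ω)
  have posC : ∀ ω, p ω ≠ 0 → 0 < law p C (C ω) := fun ω h =>
    ((hp ω).lt_of_ne' h).trans_le (le_law hp C ω)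
  have posD : ∀ ω, p ω ≠ 0 → 0 < law p D (D ω) := fun ω h =>
    ((hp ω).lt_of_ne' h).trans_le (le_law hp D ω)
  have key : ∑ ω, p ω * (law p A (A ω) * law p B (B ω) / (law p D (D ω) * law p C (C ω)))
      ≤ ∑ ω, p ω := by
    have e1 : ∑ ω, p ω * (law p A (A ω) * law p B (B ω) / (law p D (D ω) * law p C (C ω)))
        = ∑ a, ∑ b, p a * p b * ∑ ω, if A ω = A a ∧ B ω = B b then
            p ω / (law p D (D ω) * law p C (C ω)) else 0 := by
      simp only [Finset.mul_sum]
      rw [Finset.sum_congr rfl fun a _ => Finset.sum_comm, Finset.sum_comm]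
      refine Finset.sum_congr rfl fun ω _ => ?_
      rw [law_eq_sum_mul p A, law_eq_sum_mul p B, Finset.sum_mul_sum, Finset.sum_div,
        Finset.mul_sum]
      refine Finset.sum_congr rfl fun a _ => ?_
      rw [Finset.sum_div, Finset.mul_sum]
      refine Finset.sum_congr rfl fun b _ => ?_
      by_cases h1 : A ω = A a <;> by_cases h2 : B ω = B b <;>
        (simp [h1, h2, eq_comm]; try ring)
    rw [e1]
    refine Finset.sum_le_sum fun a _ => ?_
    rcases (hp a).eq_or_lt with h0 | h0
    · simp [← h0]
    have hb : ∀ b, (∑ ω, if A ω = A a ∧ B ω = B b then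
        p ω / (law p D (D ω) * law p C (C ω)) else 0) ≤
        (if C b = C a then 1 else 0) / law p C (C a) := by
      intro b
      by_cases hne : ∃ ω₀, A ω₀ = A a ∧ B ω₀ = B b
      · obtain ⟨ω₀, h1, h2⟩ := hne
        have hc : C b = C a := (hB _ _ h2).symm.trans (hA _ _ h1)
        have : (∑ ω, if A ω = A a ∧ B ω = B b then
            p ω / (law p D (D ω) * law p C (C ω)) else 0) ≤
            ∑ ω, (if D ω = D ω₀ then p ω else 0) * (1 / (law p D (D ω₀) * law p C (C a))) := by
          refine Finset.sum_le_sum fun ω _ => ?_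
          by_cases h : A ω = A a ∧ B ω = B b
          · have hd : D ω = D ω₀ := hD _ _ (h.1.trans h1.symm) (h.2.trans h2.symm)
            rw [if_pos h, if_pos hd, hd, hA _ _ h.1, mul_one_div]
          · rw [if_neg h]
            refine mul_nonneg (by split_ifs <;> simp [hp]) (one_div_nonneg.2 (mul_nonneg
              (law_nonneg hp _ _) (law_nonneg hp _ _)))
        refine this.trans ?_
        rw [← Finset.sum_mul, if_pos hc]
        change law p D (D ω₀) * _ ≤ _
        rcases (law_nonneg hp D (D ω₀)).eq_or_lt with h | h
        · rw [← h]; simpa using (posC a h0.ne').le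
        · exact le_of_eq (by have := posC a h0.ne'; field_simp)
      · push Not at hne
        rw [Finset.sum_eq_zero fun ω _ => if_neg fun h => hne ω h.1 h.2]
        exact div_nonneg (by split_ifs <;> simp) (law_nonneg hp _ _)
    calc _ ≤ ∑ b, p a * p b * ((if C b = C a then 1 else 0) / law p C (C a)) :=
          Finset.sum_le_sum fun b _ => mul_le_mul_of_nonneg_left (hb b) (mul_nonneg h0.le (hp b))
      _ = p a / law p C (C a) * law p C (C a) := by
          rw [law_eq_sum_mul p C (C a), Finset.mul_sum]
          refine Finset.sum_congr rfl fun b _ => ?_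
          ring
      _ = p a := div_mul_cancel₀ _ (posC a h0.ne').ne'
  have h2 : ∀ ω, p ω * (Real.log (law p A (A ω)) + Real.log (law p B (B ω))
      - Real.log (law p D (D ω)) - Real.log (law p C (C ω))) ≤
      p ω * (law p A (A ω) * law p B (B ω) / (law p D (D ω) * law p C (C ω))) - p ω := by
    intro ω
    by_cases h0 : p ω = 0
    · simp [h0]
    · have a := posA ω h0
      have b := posB ω h0
      have c := posC ω h0
      have d := posD ω h0
      have := Real.log_le_sub_one_of_pos (div_pos (mul_pos a b) (mul_pos d c))
      rw [Real.log_div (mul_pos a b).ne' (mul_pos d c).ne', Real.log_mul a.ne' b.ne',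
        Real.log_mul d.ne' c.ne'] at this
      have := mul_le_mul_of_nonneg_left this (hp ω)
      linarith
  have h3 := Finset.sum_le_sum fun ω (_ : ω ∈ Finset.univ) => h2 ω
  simp only [mul_sub, mul_add, Finset.sum_sub_distrib, Finset.sum_add_distrib] at h3
  unfold shEnt
  linarith

theorem shEnt_pair_le {p : Ω → ℝ} (hp : p ∈ stdSimplex ℝ Ω) (X : Ω → S) (Y : Ω → T) :
    shEnt p (fun ω => (X ω, Y ω)) ≤ shEnt p X + shEnt p Y := by
  have := shEnt_submodular hp.1 (A := X) (B := Y) (C := fun _ => ())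
    (D := fun ω => (X ω, Y ω)) (by simp +contextual) (by simp) (by simp)
  rwa [shEnt_const hp.2, add_zero] at this

end Law

section Product

variable {Ω Ω' R S T : Type*} [Fintype Ω] [Fintype Ω']

theorem prodW_mem_stdSimplex {p : Ω → ℝ} {q : Ω' → ℝ} (hp : p ∈ stdSimplex ℝ Ω)
    (hq : q ∈ stdSimplex ℝ Ω') : prodW p q ∈ stdSimplex ℝ (Ω × Ω') := by
  refine ⟨fun ω => mul_nonneg (hp.1 _) (hq.1 _), ?_⟩
  simp only [prodW, Fintype.sum_prod_type, ← Finset.mul_sum, hq.2, mul_one, hp.2]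

theorem law_prodW_map (p : Ω → ℝ) (q : Ω' → ℝ) (X : Ω → S) (Y : Ω' → T) :
    law (prodW p q) (fun ω => (X ω.1, Y ω.2)) = prodW (law p X) (law q Y) := by
  classical
  ext ⟨s, t⟩
  simp only [prodW, law, Fintype.sum_prod_type, Finset.sum_mul_sum, Prod.mk.injEq]
  refine Finset.sum_congr rfl fun a _ => Finset.sum_congr rfl fun b _ => ?_
  by_cases h : X a = s <;> by_cases h' : Y b = t <;> simp [h, h']

theorem law_prodW_fst (p : Ω → ℝ) {q : Ω' → ℝ} (hq : ∑ ω, q ω = 1) (X : Ω → S) :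
    law (prodW p q) (fun ω => X ω.1) = law p X := by
  classical
  ext s
  simp only [law, prodW, Fintype.sum_prod_type]
  refine Finset.sum_congr rfl fun a _ => ?_
  split_ifs
  · rw [← Finset.mul_sum, hq, mul_one]
  · simp

theorem law_prodW_swap (p : Ω → ℝ) (q : Ω' → ℝ) :
    law (prodW p q) (fun ω => (ω.2, ω.1)) = prodW q p := by
  classical
  ext ⟨s, t⟩
  simp only [prodW, law, Fintype.sum_prod_type, Prod.mk.injEq]
  rw [Finset.sum_eq_single t (by simp +contextual) (by simp)]
  simp [mul_comm]

theorem law_prodW_snd {p : Ω → ℝ} (hp : ∑ ω, p ω = 1) (q : Ω' → ℝ) (X : Ω' → S) :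
    law (prodW p q) (fun ω => X ω.2) = law q X := by
  rw [← law_prodW_fst q hp X, ← law_prodW_swap p q, law_law]

theorem shEnt_prodW_fst (p : Ω → ℝ) {q : Ω' → ℝ} (hq : ∑ ω, q ω = 1) (X : Ω → S) :
    shEnt (prodW p q) (fun ω => X ω.1) = shEnt p X := by
  have := shEnt_law (prodW p q) (fun ω => ω.1) X
  rwa [law_prodW_fst p hq (fun ω => ω), law_id, eq_comm] at this

theorem shEnt_prodW_snd {p : Ω → ℝ} (hp : ∑ ω, p ω = 1) (q : Ω' → ℝ) (X : Ω' → S) :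
    shEnt (prodW p q) (fun ω => X ω.2) = shEnt q X := by
  have := shEnt_law (prodW p q) (fun ω => ω.2) X
  rwa [law_prodW_snd hp q (fun ω => ω), law_id, eq_comm] at this

theorem shEnt_prodW_map {p : Ω → ℝ} {q : Ω' → ℝ} (hp : p ∈ stdSimplex ℝ Ω)
    (hq : q ∈ stdSimplex ℝ Ω') (X : Ω → S) (Y : Ω' → T) :
    shEnt (prodW p q) (fun ω => (X ω.1, Y ω.2)) = shEnt p X + shEnt q Y := by
  rw [← shEnt_prodW_fst p hq.2 X, ← shEnt_prodW_snd hp.2 q Y]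
  unfold shEnt
  rw [law_prodW_map, law_prodW_fst p hq.2 X, law_prodW_snd hp.2 q Y, ← neg_add,
    ← Finset.sum_add_distrib]
  congr 1
  refine Finset.sum_congr rfl fun ω _ => ?_
  by_cases h : prodW p q ω = 0
  · simp [h]
  · have h1 : p ω.1 ≠ 0 := left_ne_zero_of_mul h
    have h2 : q ω.2 ≠ 0 := right_ne_zero_of_mul h
    have h3 := ((hp.1 _).lt_of_ne' h1).trans_le (le_law hp.1 X ω.1)
    have h4 := ((hq.1 _).lt_of_ne' h2).trans_le (le_law hq.1 Y ω.2)
    rw [← mul_add]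
    simp only [prodW]
    rw [Real.log_mul h3.ne' h4.ne']

end Product

section Kernel

variable {Ω R S T : Type*} [Fintype Ω] [Fintype R] [Fintype S] [Fintype T]

/-- If `κ` is a conditional law of `U` given `C`, the entropy of any function of `U` given `C`
is the average of its entropies under `κ`. -/
theorem shEnt_pair_sub_eq_sum {p : Ω → ℝ} {U : Ω → S} {C : Ω → R} {κ : R → S → ℝ}
    (hκ : ∀ c, κ c ∈ stdSimplex ℝ S)
    (h : ∀ u c, law p (fun ω => (U ω, C ω)) (u, c) = law p C c * κ c u) (g : S → T) :
    shEnt p (fun ω => (g (U ω), C ω)) - shEnt p C = ∑ c, law p C c * shEnt (κ c) g := by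
  classical
  have hg : ∀ t c, law p (fun ω => (g (U ω), C ω)) (t, c) = law p C c * law (κ c) g t := by
    intro t c
    rw [← law_law p (fun ω => (U ω, C ω)) (fun x => (g x.1, x.2))]
    simp only [law.eq_1 (law p _), Fintype.sum_prod_type, h, Prod.mk.injEq]
    rw [law.eq_1 (κ c), Finset.mul_sum]
    refine Finset.sum_congr rfl fun u _ => ?_
    by_cases hu : g u = t <;> simp [hu]
  rw [shEnt_eq_sum_negMulLog, shEnt_eq_sum_negMulLog, Fintype.sum_prod_type_right,
    ← Finset.sum_sub_distrib]
  refine Finset.sum_congr rfl fun c _ => ?_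
  rw [shEnt_eq_sum_negMulLog, Finset.mul_sum]
  simp only [hg, Real.negMulLog_mul, Finset.sum_add_distrib, ← Finset.sum_mul]
  rw [sum_law, (hκ c).2]
  simp

theorem exists_kernel {R : Type*} [Nonempty S] {p : Ω → ℝ} (hp : ∀ ω, 0 ≤ p ω) (U : Ω → S)
    (C : Ω → R) :
    ∃ κ : R → S → ℝ, (∀ c, κ c ∈ stdSimplex ℝ S) ∧
      ∀ u c, law p (fun ω => (U ω, C ω)) (u, c) = law p C c * κ c u := by
  classical
  have hsum : ∀ c, ∑ u, law p (fun ω => (U ω, C ω)) (u, c) = law p C c := by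
    intro c
    simp only [law]
    rw [Finset.sum_comm]
    refine Finset.sum_congr rfl fun ω _ => ?_
    by_cases h : C ω = c <;> simp [h]
  refine ⟨fun c u => if law p C c = 0 then (Pi.single (Classical.arbitrary S) 1 : S → ℝ) u
    else law p (fun ω => (U ω, C ω)) (u, c) / law p C c, fun c => ?_, fun u c => ?_⟩
  · by_cases h : law p C c = 0
    · simpa [h] using single_mem_stdSimplex ℝ (Classical.arbitrary S)
    · simp only [h, if_false]
      refine ⟨fun u => div_nonneg (law_nonneg hp _ _) (law_nonneg hp _ _), ?_⟩
      rw [← Finset.sum_div, hsum, div_self h]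
  · by_cases h : law p C c = 0
    · rw [h, zero_mul]
      have := hsum c
      rw [h, Finset.sum_eq_zero_iff_of_nonneg fun u _ => law_nonneg hp _ _] at this
      exact this u (Finset.mem_univ u)
    · simp only [h, if_false]
      field_simp

/-- `A` and `B` are conditionally independent given `C`. -/
def CondIndep {Ω R S T : Type*} [Fintype Ω] [Fintype S] [Fintype T] (p : Ω → ℝ)
    (A : Ω → S) (B : Ω → T) (C : Ω → R) : Prop :=
  ∃ (v : R → S → ℝ) (w : R → T → ℝ), (∀ c, v c ∈ stdSimplex ℝ S) ∧ (∀ c, w c ∈ stdSimplex ℝ T) ∧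
    ∀ x c, law p (fun ω => ((A ω, B ω), C ω)) (x, c) = law p C c * prodW (v c) (w c) x

theorem law_pair_fst {p : Ω → ℝ} {A : Ω → S} {B : Ω → T} {C : Ω → R}
    {v : R → S → ℝ} {w : R → T → ℝ} (hw : ∀ c, w c ∈ stdSimplex ℝ T)
    (h : ∀ x c, law p (fun ω => ((A ω, B ω), C ω)) (x, c) = law p C c * prodW (v c) (w c) x)
    (a : S) (c : R) : law p (fun ω => (A ω, C ω)) (a, c) = law p C c * v c a := by
  classical
  rw [← law_law p (fun ω => ((A ω, B ω), C ω)) (fun x => (x.1.1, x.2))]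
  simp only [law.eq_1 (law p _), Fintype.sum_prod_type, h, Prod.mk.injEq, prodW]
  rw [Finset.sum_eq_single a (by simp +contextual) (by simp)]
  simp [← Finset.mul_sum, (hw c).2]

theorem law_pair_snd {p : Ω → ℝ} {A : Ω → S} {B : Ω → T} {C : Ω → R}
    {v : R → S → ℝ} {w : R → T → ℝ} (hv : ∀ c, v c ∈ stdSimplex ℝ S)
    (h : ∀ x c, law p (fun ω => ((A ω, B ω), C ω)) (x, c) = law p C c * prodW (v c) (w c) x)
    (b : T) (c : R) : law p (fun ω => (B ω, C ω)) (b, c) = law p C c * w c b := by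
  classical
  rw [← law_law p (fun ω => ((A ω, B ω), C ω)) (fun x => (x.1.2, x.2))]
  simp only [law.eq_1 (law p _), Fintype.sum_prod_type, h, Prod.mk.injEq, prodW]
  rw [Finset.sum_comm, Finset.sum_eq_single b (by simp +contextual) (by simp)]
  simp [← Finset.mul_sum, ← Finset.sum_mul, (hv c).2]

theorem CondIndep.shEnt_eq {p : Ω → ℝ} {A : Ω → S} {B : Ω → T} {C : Ω → R}
    (h : CondIndep p A B C) :
    shEnt p (fun ω => ((A ω, B ω), C ω)) + shEnt p C
      = shEnt p (fun ω => (A ω, C ω)) + shEnt p (fun ω => (B ω, C ω)) := by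
  obtain ⟨v, w, hv, hw, h⟩ := h
  have h1 := shEnt_pair_sub_eq_sum (fun c => prodW_mem_stdSimplex (hv c) (hw c)) h (fun x => x)
  have h2 := shEnt_pair_sub_eq_sum hv (law_pair_fst hw h) (fun x => x)
  have h3 := shEnt_pair_sub_eq_sum hw (law_pair_snd hv h) (fun x => x)
  have h4 : ∀ c, shEnt (prodW (v c) (w c)) (fun x => x) =
      shEnt (v c) (fun x => x) + shEnt (w c) (fun x => x) := fun c =>
    shEnt_prodW_map (hv c) (hw c) (fun x => x) (fun x => x)
  simp only [h4, mul_add, Finset.sum_add_distrib] at h1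
  linarith

end Kernel

section CondIndepConstructions

variable {Ω Ω' R R' S T : Type*} [Fintype Ω] [Fintype Ω'] [Fintype R] [Fintype R'] [Fintype S]
  [Fintype T]

theorem condIndep_prodW {R R' : Type*} [Nonempty S] [Nonempty T] {p : Ω → ℝ} {q : Ω' → ℝ}
    (hp : ∀ ω, 0 ≤ p ω)
    (hq : ∀ ω, 0 ≤ q ω) (A : Ω → S) (C : Ω → R) (B : Ω' → T) (D : Ω' → R') :
    CondIndep (prodW p q) (fun ω => A ω.1) (fun ω => B ω.2) (fun ω => (C ω.1, D ω.2)) := by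
  obtain ⟨v, hv, hv'⟩ := exists_kernel hp A C
  obtain ⟨w, hw, hw'⟩ := exists_kernel hq B D
  refine ⟨fun c => v c.1, fun c => w c.2, fun c => hv _, fun c => hw _, ?_⟩
  rintro ⟨a, b⟩ ⟨c, d⟩
  have h1 := congrFun (law_prodW_map p q (fun ω => (A ω, C ω)) (fun ω => (B ω, D ω)))
    ((a, c), (b, d))
  have h2 := congrFun (law_prodW_map p q C D) (c, d)
  rw [h2]
  simp only [prodW, hv', hw'] at h1 ⊢
  rw [law_congr_event (t := ((a, c), (b, d))) (Y := fun ω => ((A ω.1, C ω.1), (B ω.2, D ω.2)))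
    (by intro ω _; simp only [Prod.mk.injEq]; tauto), h1]
  ring

theorem condIndep_prodW_const [Nonempty S] [Nonempty T] {p : Ω → ℝ} {q : Ω' → ℝ}
    (hp : p ∈ stdSimplex ℝ Ω) (hq : q ∈ stdSimplex ℝ Ω') (A : Ω → S) (B : Ω' → T) :
    CondIndep (prodW p q) (fun ω => A ω.1) (fun ω => B ω.2) (fun _ => ()) := by
  refine ⟨fun _ => law p A, fun _ => law q B, fun _ => law_mem_stdSimplex hp A,
    fun _ => law_mem_stdSimplex hq B, fun x c => ?_⟩
  rw [← law_prodW_map, law_congr_event (t := x) (Y := fun ω => (A ω.1, B ω.2)) (by simp)]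
  simp [law, (prodW_mem_stdSimplex hp hq).2]

/-- Two copies of a probability space can be coupled to be conditionally independent
given a common value of `C`. -/
theorem exists_condIndep_coupling {p : Ω → ℝ} (hp : p ∈ stdSimplex ℝ Ω) (C : Ω → R) :
    ∃ q ∈ stdSimplex ℝ (Ω × Ω), law q Prod.fst = p ∧ law q Prod.snd = p ∧
      (∀ ω, q ω ≠ 0 → C ω.1 = C ω.2) ∧
      ∀ (A : Ω → S) (B : Ω → T), CondIndep q (fun ω => A ω.1) (fun ω => B ω.2)
        (fun ω => C ω.1) := by
  classical
  have : Nonempty Ω := by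
    by_contra h
    rw [not_nonempty_iff] at h
    simpa using hp.2
  obtain ⟨κ, hκ, h⟩ := exists_kernel hp.1 (fun ω => ω) C
  have hκ' : ∀ ω c, (if C ω = c then p ω else 0) = law p C c * κ c ω := by
    intro ω c
    rw [← h, law, Finset.sum_eq_single ω (by simp +contextual) (by simp)]
    simp
  set q : Ω × Ω → ℝ := fun ω => ∑ c, law p C c * prodW (κ c) (κ c) ω with hq
  have hfst : law q Prod.fst = p := by
    ext ω
    rw [law.eq_1 q, Fintype.sum_prod_type]
    simp only [hq, prodW]
    rw [Finset.sum_eq_single ω (by simp +contextual) (by simp)]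
    simp only [if_true]
    rw [Finset.sum_comm]
    simp only [← Finset.mul_sum, (hκ _).2, mul_one, ← hκ']
    simp
  have hsnd : law q Prod.snd = p := by
    ext ω
    rw [law.eq_1 q, Fintype.sum_prod_type]
    simp only [hq, prodW]
    rw [Finset.sum_comm, Finset.sum_eq_single ω (by simp +contextual) (by simp)]
    simp only [if_true]
    rw [Finset.sum_comm]
    simp only [← Finset.mul_sum, ← Finset.sum_mul, (hκ _).2, one_mul, ← hκ']
    simp
  have hq0 : ∀ ω, 0 ≤ q ω := fun ω => Finset.sum_nonneg fun c _ =>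
    mul_nonneg (law_nonneg hp.1 _ _) ((prodW_mem_stdSimplex (hκ c) (hκ c)).1 ω)
  have hqC : ∀ ω c, (if C ω.1 = c then q ω else 0) = law p C c * prodW (κ c) (κ c) ω := by
    intro ω c
    have h1 : ∀ c', C ω.1 ≠ c' → law p C c' * prodW (κ c') (κ c') ω = 0 := by
      intro c' hc
      rw [prodW, ← mul_assoc, ← hκ', if_neg hc, zero_mul]
    by_cases hc : C ω.1 = c
    · rw [if_pos hc, hq]
      exact Finset.sum_eq_single c (fun c' _ hcc => h1 c' (by rw [hc]; exact hcc.symm)) (by simp)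
    · rw [if_neg hc, h1 c hc]
  have hlawC : law q (fun ω => C ω.1) = law p C := by
    rw [← law_law q Prod.fst, hfst]
  refine ⟨q, ⟨hq0, ?_⟩, hfst, hsnd, fun ω hω => ?_, fun A B => ?_⟩
  · rw [← sum_law q Prod.fst, hfst, hp.2]
  · by_contra hne
    refine hω ?_
    have := hqC ω (C ω.1)
    rw [if_pos rfl] at this
    rw [this, prodW, mul_left_comm, ← hκ', if_neg (Ne.symm hne), mul_zero]
  · refine ⟨fun c => law (κ c) A, fun c => law (κ c) B, fun c => law_mem_stdSimplex (hκ c) A,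
      fun c => law_mem_stdSimplex (hκ c) B, fun x c => ?_⟩
    rw [hlawC, ← law_prodW_map, law, law.eq_1 (prodW _ _), Finset.mul_sum]
    refine Finset.sum_congr rfl fun ω _ => ?_
    have := hqC ω c
    by_cases h1 : (A ω.1, B ω.2) = x
    · simpa [h1] using this
    · simp [h1]

end CondIndepConstructions

section Distance

variable {Ω R V T : Type*} [Fintype Ω] [Fintype R] [Fintype T] [AddCommGroup V] [Fintype V]

/-- The entropic Ruzsa-type distance, conditional on `C`, between `A` and the first component
of `q` given its second component. -/
noncomputable def condDist (q : V × T → ℝ) (p : Ω → ℝ) (A : Ω → V) (C : Ω → R) : ℝ :=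
  shEnt (prodW p q) (fun ω => ((A ω.1 + ω.2.1, ω.2.2), C ω.1)) - shEnt p C - shEnt q Prod.snd
    - (shEnt p (fun ω => (A ω, C ω)) - shEnt p C) / 2
    - (shEnt q (fun x => x) - shEnt q Prod.snd) / 2

/-- The entropic Ruzsa-type distance between the law `w` and the first component
of `q` given its second component. -/
noncomputable def refDist (q : V × T → ℝ) (w : V → ℝ) : ℝ :=
  shEnt (prodW w q) (fun ω => (ω.1 + ω.2.1, ω.2.2)) - shEnt q Prod.snd
    - shEnt w (fun x => x) / 2 - (shEnt q (fun x => x) - shEnt q Prod.snd) / 2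

/-- The functional `τ` minimised in the entropic proof of Marton's conjecture. -/
noncomputable def tau (η : ℝ) (q : V × T → ℝ) (v w : V → ℝ) : ℝ :=
  shEnt (prodW v w) (fun x => x.1 + x.2) - shEnt v (fun x => x) / 2 - shEnt w (fun x => x) / 2
    + η * (refDist q v + refDist q w)

theorem condDist_eq_sum {q : V × T → ℝ} (hq : q ∈ stdSimplex ℝ (V × T)) {p : Ω → ℝ}
    (hp : p ∈ stdSimplex ℝ Ω) {A : Ω → V} {C : Ω → R} {v : R → V → ℝ}
    (hv : ∀ c, v c ∈ stdSimplex ℝ V)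
    (h : ∀ a c, law p (fun ω => (A ω, C ω)) (a, c) = law p C c * v c a) :
    condDist q p A C = ∑ c, law p C c * refDist q (v c) := by
  have hC : law (prodW p q) (fun ω => C ω.1) = law p C := law_prodW_fst p hq.2 C
  have h' : ∀ (x : V × (V × T)) c, law (prodW p q) (fun ω => ((A ω.1, ω.2), C ω.1)) (x, c)
      = law (prodW p q) (fun ω => C ω.1) c * prodW (v c) q x := by
    rintro ⟨a, o⟩ c
    have h1 := congrFun (law_prodW_map p q (fun ω => (A ω, C ω)) (fun ω => ω)) ((a, c), o)
    rw [law_congr_event (t := ((a, c), o)) (Y := fun ω => ((A ω.1, C ω.1), ω.2))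
      (by intro ω _; simp only [Prod.mk.injEq]; tauto), h1, hC]
    simp only [prodW, law_id, h]
    ring
  have e1 := shEnt_pair_sub_eq_sum (fun c => prodW_mem_stdSimplex (hv c) hq) h'
    (fun x => (x.1 + x.2.1, x.2.2))
  have e2 := shEnt_pair_sub_eq_sum hv h (fun x => x)
  rw [hC, shEnt_prodW_fst p hq.2 C] at e1
  have e3 : ∑ c, law p C c = 1 := by rw [sum_law, hp.2]
  simp only [refDist, mul_sub, Finset.sum_sub_distrib, ← mul_div_assoc, ← Finset.sum_div,
    ← Finset.sum_mul, e3, ← e1, ← e2]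
  unfold condDist
  ring

theorem tau_le_of_condIndep {η τ₀ : ℝ} {q : V × T → ℝ} (hq : q ∈ stdSimplex ℝ (V × T))
    (hmin : ∀ v ∈ stdSimplex ℝ V, ∀ w ∈ stdSimplex ℝ V, τ₀ ≤ tau η q v w) {p : Ω → ℝ}
    (hp : p ∈ stdSimplex ℝ Ω) {A B : Ω → V} {C : Ω → R} (h : CondIndep p A B C) :
    τ₀ ≤ (shEnt p (fun ω => (A ω + B ω, C ω)) - shEnt p C)
      - (shEnt p (fun ω => (A ω, C ω)) - shEnt p C) / 2
      - (shEnt p (fun ω => (B ω, C ω)) - shEnt p C) / 2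
      + η * (condDist q p A C + condDist q p B C) := by
  obtain ⟨v, w, hv, hw, h⟩ := h
  have e1 := shEnt_pair_sub_eq_sum (fun c => prodW_mem_stdSimplex (hv c) (hw c)) h
    (fun x => x.1 + x.2)
  have e2 := shEnt_pair_sub_eq_sum hv (law_pair_fst hw h) (fun x => x)
  have e3 := shEnt_pair_sub_eq_sum hw (law_pair_snd hv h) (fun x => x)
  have e4 := condDist_eq_sum hq hp hv (law_pair_fst hw h)
  have e5 := condDist_eq_sum hq hp hw (law_pair_snd hv h)
  have e6 : ∑ c, law p C c = 1 := by rw [sum_law, hp.2]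
  calc τ₀ = ∑ c, law p C c * τ₀ := by rw [← Finset.sum_mul, e6, one_mul]
    _ ≤ ∑ c, law p C c * tau η q (v c) (w c) := Finset.sum_le_sum fun c _ =>
        mul_le_mul_of_nonneg_left (hmin _ (hv c) _ (hw c)) (law_nonneg hp.1 _ _)
    _ = _ := by
        rw [e1, e2, e3, e4, e5]
        simp only [Finset.sum_div, ← Finset.sum_add_distrib, Finset.mul_sum,
          ← Finset.sum_sub_distrib]
        refine Finset.sum_congr rfl fun c _ => ?_
        unfold tau
        ring

theorem refDist_law {q : V × T → ℝ} (p : Ω → ℝ) (A : Ω → V) :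
    refDist q (law p A) = shEnt (prodW p q) (fun ω => (A ω.1 + ω.2.1, ω.2.2))
      - shEnt q Prod.snd - shEnt p A / 2 - (shEnt q (fun x => x) - shEnt q Prod.snd) / 2 := by
  have h1 := shEnt_law (prodW p q) (fun ω => (A ω.1, ω.2)) (fun ω => (ω.1 + ω.2.1, ω.2.2))
  rw [law_prodW_map p q A (fun ω => ω), law_id] at h1
  rw [refDist, h1, shEnt_law_id]

theorem condDist_le {R : Type*} {q : V × T → ℝ} (hq : q ∈ stdSimplex ℝ (V × T)) {p : Ω → ℝ}
    (hp : p ∈ stdSimplex ℝ Ω) (A : Ω → V) (C : Ω → R) :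
    condDist q p A C ≤ refDist q (law p A)
      + (shEnt p A + shEnt p C - shEnt p (fun ω => (A ω, C ω))) / 2 := by
  have h1 := shEnt_pair_le (prodW_mem_stdSimplex hp hq)
    (fun ω => (A ω.1 + ω.2.1, ω.2.2)) (fun ω => C ω.1)
  rw [shEnt_prodW_fst p hq.2 C] at h1
  rw [refDist_law, condDist]
  linarith

theorem condDist_const {q : V × T → ℝ} {p : Ω → ℝ}
    (hp : p ∈ stdSimplex ℝ Ω) (A : Ω → V) :
    condDist q p A (fun _ => ()) = refDist q (law p A) := by
  rw [refDist_law, condDist, shEnt_const hp.2]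
  rw [shEnt_congr (p := prodW p q) (Y := fun ω => (A ω.1 + ω.2.1, ω.2.2)) (by simp),
    shEnt_congr (p := p) (X := fun ω => (A ω, ())) (Y := A) (by simp)]
  ring

theorem refDist_add_le {q : V × T → ℝ} (hq : q ∈ stdSimplex ℝ (V × T)) {p : Ω → ℝ}
    (hp : p ∈ stdSimplex ℝ Ω) (A B : Ω → V)
    (h : shEnt p (fun ω => (A ω, B ω)) = shEnt p A + shEnt p B) :
    refDist q (law p (fun ω => A ω + B ω)) ≤ refDist q (law p A)
      + (shEnt p (fun ω => A ω + B ω) - shEnt p A) / 2 := by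
  have hpq := prodW_mem_stdSimplex hp hq
  have h1 := shEnt_submodular hpq.1
    (A := fun ω => ((A ω.1 + ω.2.1, ω.2.2), B ω.1)) (B := fun ω => (A ω.1 + B ω.1, ω.2))
    (C := fun ω => (A ω.1 + B ω.1 + ω.2.1, ω.2.2)) (D := fun ω => ((A ω.1, B ω.1), ω.2))
    (by
      rintro ⟨a, x, y⟩ ⟨b, x', y'⟩ h1 h2
      simp only [Prod.mk.injEq] at h1 h2 ⊢
      obtain ⟨h3, h4, h5⟩ := h2
      have h6 := h1.1.1
      rw [h4] at h6
      exact ⟨⟨add_right_cancel h6, h1.2⟩, h4, h5⟩)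
    (by
      rintro ⟨a, x, y⟩ ⟨b, x', y'⟩ h1
      simp only [Prod.mk.injEq] at h1 ⊢
      rw [add_right_comm, h1.1.1, h1.2, add_right_comm]
      exact ⟨rfl, h1.1.2⟩)
    (by
      rintro ⟨a, x, y⟩ ⟨b, x', y'⟩ h1
      simp only [Prod.mk.injEq] at h1 ⊢
      rw [h1.1, h1.2.1]
      exact ⟨rfl, h1.2.2⟩)
  have h2 := shEnt_pair_le hpq (fun ω => (A ω.1 + ω.2.1, ω.2.2)) (fun ω => B ω.1)
  rw [shEnt_prodW_fst p hq.2 B] at h2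
  rw [shEnt_prodW_map hp hq (fun ω => (A ω, B ω)) (fun x => x),
    shEnt_prodW_map hp hq (fun ω => A ω + B ω) (fun x => x), h] at h1
  rw [refDist_law, refDist_law]
  linarith

theorem refDist_nonneg {q : V × T → ℝ} (hq : q ∈ stdSimplex ℝ (V × T)) {w : V → ℝ}
    (hw : w ∈ stdSimplex ℝ V) : 0 ≤ refDist q w := by
  have hpq := prodW_mem_stdSimplex hw hq
  have h1 := shEnt_submodular hpq.1
    (A := fun ω => (ω.1 + ω.2.1, ω.2.2)) (B := fun ω => ω.1)
    (C := fun ω => ()) (D := fun ω => (ω.1, ω.2))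
    (by
      rintro ⟨a, x, y⟩ ⟨b, x', y'⟩ h1 h2
      simp only [Prod.mk.injEq] at h1 h2 ⊢
      rw [h2] at h1
      exact ⟨h2, add_left_cancel h1.1, h1.2⟩)
    (by simp) (by simp)
  have h2 := shEnt_submodular hpq.1
    (A := fun ω => (ω.1 + ω.2.1, ω.2.2)) (B := fun ω => ω.2)
    (C := fun ω => ω.2.2) (D := fun ω => (ω.1, ω.2))
    (by
      rintro ⟨a, x, y⟩ ⟨b, x', y'⟩ h1 h2
      simp only [Prod.mk.injEq] at h1 h2 ⊢
      rw [h2.1] at h1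
      exact ⟨add_right_cancel h1.1, h2⟩)
    (by simp +contextual) (by simp +contextual)
  rw [shEnt_const hpq.2, shEnt_prodW_map hw hq (fun x => x) (fun x => x),
    shEnt_prodW_fst w hq.2 (fun x => x)] at h1
  rw [shEnt_prodW_map hw hq (fun x => x) (fun x => x),
    shEnt_prodW_snd hw.2 q (fun x => x), shEnt_prodW_snd hw.2 q (fun x => x.2)] at h2
  unfold refDist
  change 0 ≤ _ - shEnt q (fun x => x.2) - _ - (_ - shEnt q (fun x => x.2)) / 2
  linarith

theorem continuous_shEnt {α S : Type*} [TopologicalSpace α] [Fintype S] (p : α → Ω → ℝ)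
    (hp : ∀ ω, Continuous fun x => p x ω) (X : Ω → S) : Continuous fun x => shEnt (p x) X := by
  classical
  simp only [shEnt_eq_sum_negMulLog, law_eq_sum_mul]
  fun_prop

theorem exists_tau_minimizer (η : ℝ) (q : V × T → ℝ) :
    ∃ v ∈ stdSimplex ℝ V, ∃ w ∈ stdSimplex ℝ V,
      ∀ v' ∈ stdSimplex ℝ V, ∀ w' ∈ stdSimplex ℝ V, tau η q v w ≤ tau η q v' w' := by
  classical
  have hne : (stdSimplex ℝ V ×ˢ stdSimplex ℝ V).Nonempty :=
    ⟨(_, _), single_mem_stdSimplex ℝ 0, single_mem_stdSimplex ℝ 0⟩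
  have hc : Continuous fun x : (V → ℝ) × (V → ℝ) => tau η q x.1 x.2 := by
    have h1 : Continuous fun x : (V → ℝ) × (V → ℝ) =>
        shEnt (prodW x.1 x.2) (fun y => y.1 + y.2) :=
      continuous_shEnt _ (by intro ω; unfold prodW; fun_prop) _
    have h2 : Continuous fun x : V → ℝ => shEnt x (fun y => y) :=
      continuous_shEnt _ (by intro ω; fun_prop) _
    have h3 : Continuous fun x : V → ℝ =>
        shEnt (prodW x q) (fun ω => (ω.1 + ω.2.1, ω.2.2)) :=
      continuous_shEnt _ (by intro ω; unfold prodW; fun_prop) _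
    have h4 : Continuous fun x : V → ℝ => refDist q x :=
      ((h3.sub continuous_const).sub (h2.div_const 2)).sub continuous_const
    exact ((h1.sub ((h2.comp continuous_fst).div_const 2)).sub
      ((h2.comp continuous_snd).div_const 2)).add
      (continuous_const.mul ((h4.comp continuous_fst).add (h4.comp continuous_snd)))
  obtain ⟨x, hx, hmin⟩ := ((isCompact_stdSimplex ℝ V).prod
    (isCompact_stdSimplex ℝ V)).exists_isMinOn hne hc.continuousOn
  exact ⟨x.1, hx.1, x.2, hx.2, fun v' hv' w' hw' =>
    isMinOn_iff.1 hmin (v', w') ⟨hv', hw'⟩⟩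

end Distance

section Fibring

theorem shEnt_congr_of_comp {Ω S T : Type*} [Fintype Ω] {p : Ω → ℝ} {X : Ω → S} {Y : Ω → T}
    (f : S → T) (g : T → S) (hf : ∀ ω, p ω ≠ 0 → f (X ω) = Y ω)
    (hg : ∀ ω, p ω ≠ 0 → g (Y ω) = X ω) : shEnt p X = shEnt p Y :=
  shEnt_congr fun ω ω' h h' =>
    ⟨fun e => by rw [← hf ω h, ← hf ω' h', e], fun e => by rw [← hg ω h, ← hg ω' h', e]⟩

theorem shEnt_pair_unit {Ω S : Type*} [Fintype Ω] (p : Ω → ℝ) (X : Ω → S) :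
    shEnt p (fun ω => (X ω, ())) = shEnt p X :=
  shEnt_congr (by simp)

theorem law_equiv {Ω Ω' : Type*} [Fintype Ω] (p : Ω → ℝ) (e : Ω ≃ Ω') :
    law p e = fun x => p (e.symm x) := by
  classical
  ext x
  simp only [law, ← Equiv.eq_symm_apply]
  simp

variable {V T : Type*} [Fintype T] [AddCommGroup V] [Module (ZMod 2) V] [Fintype V]

/-- The estimate obtained from two copies of `(U, U', S)` that are conditionally independent
given `(U + U', S)`. -/
theorem tau_le_of_fibre {Ω : Type*} [Fintype Ω] {η τ₀ : ℝ} {q : V × T → ℝ}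
    (hq : q ∈ stdSimplex ℝ (V × T)) (hη : 0 ≤ η)
    (hmin : ∀ v ∈ stdSimplex ℝ V, ∀ w ∈ stdSimplex ℝ V, τ₀ ≤ tau η q v w) {p : Ω → ℝ}
    (hp : p ∈ stdSimplex ℝ Ω) (U U' S : Ω → V) :
    τ₀ ≤ 2 * shEnt p (fun ω => (U ω, S ω)) + 2 * shEnt p (fun ω => (U' ω, S ω))
      + 2 * shEnt p (fun ω => (U ω + U' ω, S ω)) - 3 * shEnt p (fun ω => ((U ω, U' ω), S ω))
      - 3 * shEnt p S
      + η * (refDist q (law p U) + refDist q (law p U') + (shEnt p U + shEnt p U') / 2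
        + shEnt p (fun ω => (U ω + U' ω, S ω)) - shEnt p (fun ω => ((U ω, U' ω), S ω))) := by
  have hz : ∀ x : V, x + x = 0 := ZModModule.add_self
  obtain ⟨Q, hQs, hQ₁, hQ₂, hQC, hQI⟩ :=
    exists_condIndep_coupling (S := V) (T := V) hp (fun ω => (U ω + U' ω, S ω))
  have hI := hQI U U'
  have hmain := tau_le_of_condIndep hq hmin hQs hI
  have eI := hI.shEnt_eq
  have hW : ∀ ω, Q ω ≠ 0 → U ω.1 + U' ω.2 = U' ω.1 + U ω.2 := by
    intro ω hω
    have h1 := congrArg Prod.fst (hQC ω hω)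
    simp only at h1
    linear_combination (norm := module) h1 + hz (U' ω.2) - hz (U' ω.1)
  have hSS : ∀ ω, Q ω ≠ 0 → S ω.1 = S ω.2 := fun ω hω => congrArg Prod.snd (hQC ω hω)
  have hWS : ∀ ω, Q ω ≠ 0 → U ω.1 + U' ω.1 = U ω.2 + U' ω.2 := fun ω hω =>
    congrArg Prod.fst (hQC ω hω)
  have eC : shEnt Q (fun ω => (U ω.1 + U' ω.1, S ω.1)) = shEnt p (fun ω => (U ω + U' ω, S ω)) := by
    rw [← shEnt_law Q Prod.fst fun ω => (U ω + U' ω, S ω), hQ₁]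
  have eS : shEnt Q (fun ω => S ω.1) = shEnt p S := by
    rw [← shEnt_law Q Prod.fst fun ω => S ω, hQ₁]
  have eUS : shEnt Q (fun ω => (U ω.1, S ω.1)) = shEnt p (fun ω => (U ω, S ω)) := by
    rw [← shEnt_law Q Prod.fst fun ω => (U ω, S ω), hQ₁]
  have eU'S : shEnt Q (fun ω => (U' ω.1, S ω.1)) = shEnt p (fun ω => (U' ω, S ω)) := by
    rw [← shEnt_law Q Prod.fst fun ω => (U' ω, S ω), hQ₁]
  have eUS₂ : shEnt Q (fun ω => (U ω.2, S ω.1)) = shEnt p (fun ω => (U ω, S ω)) := by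
    rw [← hQ₂, shEnt_law]
    refine shEnt_congr_of_comp id id ?_ ?_ <;> intro ω hω <;> simp [hSS ω hω]
  have eU'S₂ : shEnt Q (fun ω => (U' ω.2, S ω.1)) = shEnt p (fun ω => (U' ω, S ω)) := by
    rw [← hQ₂, shEnt_law]
    refine shEnt_congr_of_comp id id ?_ ?_ <;> intro ω hω <;> simp [hSS ω hω]
  have eUC : shEnt Q (fun ω => (U ω.1, (U ω.1 + U' ω.1, S ω.1)))
      = shEnt p (fun ω => ((U ω, U' ω), S ω)) := by
    rw [← hQ₁, shEnt_law]
    exact shEnt_congr_of_comp (fun x => ((x.1, x.2.1 - x.1), x.2.2))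
      (fun x => (x.1.1, (x.1.1 + x.1.2, x.2))) (by simp) (by simp)
  have eU'C : shEnt Q (fun ω => (U' ω.2, (U ω.1 + U' ω.1, S ω.1)))
      = shEnt p (fun ω => ((U ω, U' ω), S ω)) := by
    rw [← hQ₂, shEnt_law]
    refine shEnt_congr_of_comp (fun x => ((x.2.1 - x.1, x.1), x.2.2))
      (fun x => (x.1.2, (x.1.1 + x.1.2, x.2))) ?_ ?_ <;> intro ω hω <;>
      simp [hSS ω hω, hWS ω hω]
  have lU : law Q (fun ω => U ω.1) = law p U := by rw [← hQ₁, law_law]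
  have lU' : law Q (fun ω => U' ω.2) = law p U' := by rw [← hQ₂, law_law]
  have eU : shEnt Q (fun ω => U ω.1) = shEnt p U := by rw [← shEnt_law_id, lU, shEnt_law_id]
  have eU' : shEnt Q (fun ω => U' ω.2) = shEnt p U' := by rw [← shEnt_law_id, lU', shEnt_law_id]
  have sub₁ := shEnt_submodular hQs.1 (A := fun ω => (U ω.1, (U ω.1 + U' ω.2, S ω.1)))
    (B := fun ω => (U' ω.1, (U ω.1 + U' ω.2, S ω.1))) (C := fun ω => (U ω.1 + U' ω.2, S ω.1))
    (D := fun ω => ((U ω.1, U' ω.2), (U ω.1 + U' ω.1, S ω.1)))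
    (by
      intro ω ω' h h'
      simp only [Prod.mk.injEq] at h h' ⊢
      refine ⟨⟨h.1, add_left_cancel (h.1 ▸ h.2.1)⟩, ?_, h.2.2⟩
      rw [h.1, h'.1])
    (by simp +contextual) (by simp +contextual)
  have sub₂ := shEnt_submodular hQs.1 (A := fun ω => (U ω.1, S ω.1))
    (B := fun ω => (U' ω.2, S ω.1)) (C := fun ω => S ω.1)
    (D := fun ω => (U ω.1, (U ω.1 + U' ω.2, S ω.1)))
    (by simp +contextual) (by simp +contextual) (by simp +contextual)
  have sub₃ := shEnt_submodular hQs.1 (A := fun ω => (U' ω.1, S ω.1))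
    (B := fun ω => (U ω.2, S ω.1)) (C := fun ω => S ω.1)
    (D := fun ω => (U' ω.1, (U' ω.1 + U ω.2, S ω.1)))
    (by simp +contextual) (by simp +contextual) (by simp +contextual)
  have hD : shEnt Q (fun ω => (U' ω.1, (U' ω.1 + U ω.2, S ω.1)))
      = shEnt Q (fun ω => (U' ω.1, (U ω.1 + U' ω.2, S ω.1))) := by
    refine shEnt_congr_of_comp id id ?_ ?_ <;> intro ω hω <;> simp [hW ω hω]
  have sub₄ := shEnt_submodular hQs.1 (A := fun ω => (U ω.1 + U' ω.2, S ω.1))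
    (B := fun ω => (U ω.1 + U' ω.1, S ω.1)) (C := fun ω => S ω.1)
    (D := fun ω => (U ω.1 + U' ω.2, (U ω.1 + U' ω.1, S ω.1)))
    (by simp +contextual) (by simp +contextual) (by simp +contextual)
  have d₁ := condDist_le hq hQs (fun ω => U ω.1) (fun ω => (U ω.1 + U' ω.1, S ω.1))
  have d₂ := condDist_le hq hQs (fun ω => U' ω.2) (fun ω => (U ω.1 + U' ω.1, S ω.1))
  rw [eUC, lU, eU, eC] at d₁
  rw [eU'C, lU', eU', eC] at d₂
  have d := mul_le_mul_of_nonneg_left (add_le_add d₁ d₂) hη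
  rw [eUC, eU'C, eC] at hmain eI
  rw [eUS, eU'S₂, eS] at sub₂
  rw [eU'S, eUS₂, eS, hD] at sub₃
  rw [eC, eS] at sub₄
  linarith

/-- A minimiser of `tau` has vanishing entropic Ruzsa distance. -/
theorem shEnt_add_le_of_tau_minimizer {q : V × T → ℝ} (hq : q ∈ stdSimplex ℝ (V × T))
    {v w : V → ℝ} (hv : v ∈ stdSimplex ℝ V) (hw : w ∈ stdSimplex ℝ V)
    (hmin : ∀ v' ∈ stdSimplex ℝ V, ∀ w' ∈ stdSimplex ℝ V,
      tau (1 / 50) q v w ≤ tau (1 / 50) q v' w') :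
    shEnt (prodW v w) (fun x => x.1 + x.2)
      ≤ (shEnt v (fun x => x) + shEnt w (fun x => x)) / 2 := by
  have hz : ∀ x : V, x + x = 0 := ZModModule.add_self
  have hvw := prodW_mem_stdSimplex hv hw
  have hwv := prodW_mem_stdSimplex hw hv
  have hvv := prodW_mem_stdSimplex hv hv
  have hww := prodW_mem_stdSimplex hw hw
  have hswap : law (prodW w v) (fun x => x.1 + x.2) = law (prodW v w) (fun x => x.1 + x.2) := by
    rw [← law_prodW_swap v w, law_law]
    simp only [add_comm]
  have hσ' : shEnt (prodW w v) (fun x => x.1 + x.2) = shEnt (prodW v w) (fun x => x.1 + x.2) := by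
    rw [← shEnt_law_id, hswap, shEnt_law_id]
  set L := law (prodW v w) (fun x => x.1 + x.2) with hL
  set σ := shEnt (prodW v w) (fun x => x.1 + x.2) with hσ
  set h₁ := shEnt v (fun x => x) with hh₁
  set h₂ := shEnt w (fun x => x) with hh₂
  set s₁ := shEnt (prodW v v) (fun x => x.1 + x.2) with hs₁
  set s₂ := shEnt (prodW w w) (fun x => x.1 + x.2) with hs₂
  have hτ : tau (1 / 50) q v w = σ - h₁ / 2 - h₂ / 2 + 1 / 50 * (refDist q v + refDist q w) := rfl
  rw [hτ] at hmin
  -- distances of sums to the reference variable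
  have sumDist : ∀ v' ∈ stdSimplex ℝ V, ∀ w' ∈ stdSimplex ℝ V,
      refDist q (law (prodW v' w') fun x => x.1 + x.2) ≤ refDist q v'
        + (shEnt (prodW v' w') (fun x => x.1 + x.2) - shEnt v' (fun x => x)) / 2 := by
    intro v' hv' w' hw'
    have := refDist_add_le hq (prodW_mem_stdSimplex hv' hw') (fun x => x.1) (fun x => x.2)
      (by rw [shEnt_prodW_map hv' hw' (fun x => x) (fun x => x),
        shEnt_prodW_fst v' hw'.2 (fun x => x), shEnt_prodW_snd hv'.2 w' (fun x => x)])
    rwa [law_prodW_fst v' hw'.2 (fun x => x), law_id,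
      shEnt_prodW_fst v' hw'.2 (fun x => x)] at this
  have hR₁ : refDist q L ≤ refDist q v + (σ - h₁) / 2 := sumDist v hv w hw
  have hR₂ : refDist q L ≤ refDist q w + (σ - h₂) / 2 := by
    have := sumDist w hw v hv
    rwa [hswap, hσ'] at this
  have hR₃ := sumDist v hv v hv
  have hR₄ := sumDist w hw w hw
  -- four independent variables, distributed as `v`, `w`, `w`, `v`
  set P := prodW (prodW v w) (prodW w v) with hP
  have hPs : P ∈ stdSimplex ℝ _ := prodW_mem_stdSimplex hvw hwv
  have hPid : shEnt P (fun ω => ω) = 2 * (h₁ + h₂) := by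
    rw [shEnt_prodW_map hvw hwv (fun x => x) (fun x => x),
      shEnt_prodW_map hv hw (fun x => x) (fun x => x),
      shEnt_prodW_map hw hv (fun x => x) (fun x => x)]
    ring
  have la : law P (fun ω => ω.1.1) = v := by
    rw [hP, law_prodW_fst (prodW v w) hwv.2 (fun x => x.1), law_prodW_fst v hw.2 (fun x => x),
      law_id]
  have lb' : law P (fun ω => ω.1.2) = w := by
    rw [hP, law_prodW_fst (prodW v w) hwv.2 (fun x => x.2), law_prodW_snd hv.2 w (fun x => x),
      law_id]
  have lb : law P (fun ω => ω.2.1) = w := by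
    rw [hP, law_prodW_snd hvw.2 (prodW w v) (fun x => x.1), law_prodW_fst w hv.2 (fun x => x),
      law_id]
  have la' : law P (fun ω => ω.2.2) = v := by
    rw [hP, law_prodW_snd hvw.2 (prodW w v) (fun x => x.2), law_prodW_snd hw.2 v (fun x => x),
      law_id]
  have ha : shEnt P (fun ω => ω.1.1) = h₁ := by rw [← shEnt_law_id, la]
  have hb' : shEnt P (fun ω => ω.1.2) = h₂ := by rw [← shEnt_law_id, lb']
  have hb : shEnt P (fun ω => ω.2.1) = h₂ := by rw [← shEnt_law_id, lb]
  have ha' : shEnt P (fun ω => ω.2.2) = h₁ := by rw [← shEnt_law_id, la']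
  have lab' : law P (fun ω => ω.1.1 + ω.1.2) = L :=
    law_prodW_fst (prodW v w) hwv.2 (fun x => x.1 + x.2)
  have lba' : law P (fun ω => ω.2.1 + ω.2.2) = L := by
    rw [hP, law_prodW_snd hvw.2 (prodW w v) (fun x => x.1 + x.2), hswap]
  have lab : law P (fun ω => ω.1.1 + ω.2.1) = L := by
    have := law_law P (fun ω => (ω.1.1, ω.2.1)) (fun x => x.1 + x.2)
    rw [hP, law_prodW_map (prodW v w) (prodW w v) (fun x => x.1) (fun x => x.1),
      law_prodW_fst v hw.2 (fun x => x), law_prodW_fst w hv.2 (fun x => x), law_id, law_id] at this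
    exact this.symm
  have lb'a' : law P (fun ω => ω.1.2 + ω.2.2) = L := by
    have := law_law P (fun ω => (ω.1.2, ω.2.2)) (fun x => x.1 + x.2)
    rw [hP, law_prodW_map (prodW v w) (prodW w v) (fun x => x.2) (fun x => x.2),
      law_prodW_snd hv.2 w (fun x => x), law_prodW_snd hw.2 v (fun x => x), law_id, law_id] at this
    rw [← hswap, this]
  have laa' : law P (fun ω => ω.1.1 + ω.2.2) = law (prodW v v) (fun x => x.1 + x.2) := by
    have := law_law P (fun ω => (ω.1.1, ω.2.2)) (fun x => x.1 + x.2)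
    rw [hP, law_prodW_map (prodW v w) (prodW w v) (fun x => x.1) (fun x => x.2),
      law_prodW_fst v hw.2 (fun x => x), law_prodW_snd hw.2 v (fun x => x), law_id] at this
    exact this.symm
  have lb'b : law P (fun ω => ω.1.2 + ω.2.1) = law (prodW w w) (fun x => x.1 + x.2) := by
    have := law_law P (fun ω => (ω.1.2, ω.2.1)) (fun x => x.1 + x.2)
    rw [hP, law_prodW_map (prodW v w) (prodW w v) (fun x => x.2) (fun x => x.1),
      law_prodW_snd hv.2 w (fun x => x), law_prodW_fst w hv.2 (fun x => x), law_id] at this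
    exact this.symm
  have hab' : shEnt P (fun ω => ω.1.1 + ω.1.2) = σ := by rw [← shEnt_law_id, lab', shEnt_law_id]
  have hba' : shEnt P (fun ω => ω.2.1 + ω.2.2) = σ := by rw [← shEnt_law_id, lba', shEnt_law_id]
  have hab : shEnt P (fun ω => ω.1.1 + ω.2.1) = σ := by rw [← shEnt_law_id, lab, shEnt_law_id]
  have hb'a' : shEnt P (fun ω => ω.1.2 + ω.2.2) = σ := by
    rw [← shEnt_law_id, lb'a', shEnt_law_id]
  have haa' : shEnt P (fun ω => ω.1.1 + ω.2.2) = s₁ := by rw [← shEnt_law_id, laa', shEnt_law_id]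
  have hb'b : shEnt P (fun ω => ω.1.2 + ω.2.1) = s₂ := by rw [← shEnt_law_id, lb'b, shEnt_law_id]
  -- the sum of all four variables
  set S : (V × V) × (V × V) → V := fun ω => (ω.1.1 + ω.1.2) + (ω.2.1 + ω.2.2) with hS
  set U : (V × V) × (V × V) → V := fun ω => ω.1.1 + ω.2.1 with hU
  set U' : (V × V) × (V × V) → V := fun ω => ω.2.1 + ω.2.2 with hU'
  set W : (V × V) × (V × V) → V := fun ω => ω.1.1 + ω.2.2 with hW
  set t := shEnt P (fun ω => ((U ω, U' ω), S ω)) with ht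
  have hWU : ∀ ω, U ω + U' ω = W ω := fun ω => by
    simp only [hU, hU', hW]
    linear_combination (norm := module) hz ω.2.1
  have bS : σ + 49 / 50 * (σ - h₁ / 2 - h₂ / 2) ≤ shEnt P S := by
    have := tau_le_of_condIndep hq hmin hPs
      (condIndep_prodW_const hvw hwv (fun x => x.1 + x.2) (fun x => x.1 + x.2))
    rw [condDist_const hPs (fun ω => ω.1.1 + ω.1.2), condDist_const hPs (fun ω => ω.2.1 + ω.2.2),
      lab', lba', shEnt_const hPs.2,
      shEnt_pair_unit P (fun ω => ω.1.1 + ω.1.2 + (ω.2.1 + ω.2.2)),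
      shEnt_pair_unit P (fun ω => ω.1.1 + ω.1.2),
      shEnt_pair_unit P (fun ω => ω.2.1 + ω.2.2),
      hab', hba'] at this
    linarith
  have bT : 3 * σ - 51 / 50 * (σ - h₁ / 2 - h₂ / 2) ≤ t := by
    have := tau_le_of_condIndep hq hmin hPs
      (condIndep_prodW hvw.1 hwv.1 (fun x => x.1) (fun x => x.1 + x.2)
        (fun x => x.1) (fun x => x.1 + x.2))
    have e₁ : shEnt P (fun ω => (ω.1.1 + ω.1.2, ω.2.1 + ω.2.2)) = σ + σ := by
      rw [shEnt_prodW_map hvw hwv (fun x => x.1 + x.2) (fun x => x.1 + x.2), hσ']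
    have e₂ : shEnt P (fun ω => (ω.1.1, (ω.1.1 + ω.1.2, ω.2.1 + ω.2.2))) = h₁ + h₂ + σ := by
      rw [shEnt_congr_of_comp (Y := fun ω => (ω.1, ω.2.1 + ω.2.2))
        (fun x => ((x.1, x.2.1 - x.1), x.2.2)) (fun x => (x.1.1, (x.1.1 + x.1.2, x.2)))
        (by simp) (by simp), shEnt_prodW_map hvw hwv (fun x => x) (fun x => x.1 + x.2), hσ',
        shEnt_prodW_map hv hw (fun x => x) (fun x => x)]
    have e₃ : shEnt P (fun ω => (ω.2.1, (ω.1.1 + ω.1.2, ω.2.1 + ω.2.2))) = h₁ + h₂ + σ := by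
      rw [shEnt_congr_of_comp (Y := fun ω => (ω.1.1 + ω.1.2, ω.2))
        (fun x => (x.2.1, (x.1, x.2.2 - x.1))) (fun x => (x.2.1, (x.1, x.2.1 + x.2.2)))
        (by simp) (by simp), shEnt_prodW_map hvw hwv (fun x => x.1 + x.2) (fun x => x),
        shEnt_prodW_map hw hv (fun x => x) (fun x => x)]
      ring
    have e₄ : shEnt P (fun ω => (ω.1.1 + ω.2.1, (ω.1.1 + ω.1.2, ω.2.1 + ω.2.2))) = t :=
      shEnt_congr_of_comp (fun x => ((x.1, x.2.2), x.2.1 + x.2.2))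
        (fun x => (x.1.1, (x.2 - x.1.2, x.1.2))) (by simp [hU, hU', hS]) (by simp [hU, hU', hS])
    have d₁ := condDist_le hq hPs (fun ω => ω.1.1) (fun ω => (ω.1.1 + ω.1.2, ω.2.1 + ω.2.2))
    have d₂ := condDist_le hq hPs (fun ω => ω.2.1) (fun ω => (ω.1.1 + ω.1.2, ω.2.1 + ω.2.2))
    rw [e₁, e₂, e₃, e₄] at this
    rw [e₁, e₂, la, ha] at d₁
    rw [e₁, e₃, lb, hb] at d₂
    linarith
  have bUS : shEnt P (fun ω => (U ω, S ω)) ≤ 2 * σ := by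
    have := shEnt_pair_le hPs U (fun ω => ω.1.2 + ω.2.2)
    rw [hab, hb'a', shEnt_congr_of_comp (Y := fun ω => (U ω, S ω)) (fun x => (x.1, x.1 + x.2))
      (fun x => (x.1, x.2 - x.1)) (by intros; simp only [hU, hS]; congr 1; abel)
      (by intros; simp only [hU, hS]; congr 1; abel)] at this
    linarith
  have bU'S : shEnt P (fun ω => (U' ω, S ω)) ≤ 2 * σ := by
    have := shEnt_pair_le hPs U' (fun ω => ω.1.1 + ω.1.2)
    rw [hba', hab', shEnt_congr_of_comp (Y := fun ω => (U' ω, S ω)) (fun x => (x.1, x.1 + x.2))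
      (fun x => (x.1, x.2 - x.1)) (by intros; simp only [hU', hS]; congr 1; abel)
      (by intros; simp only [hU', hS]; congr 1; abel)] at this
    linarith
  have bWS : shEnt P (fun ω => (W ω, S ω)) ≤ s₁ + s₂ := by
    have := shEnt_pair_le hPs W (fun ω => ω.1.2 + ω.2.1)
    rw [haa', hb'b, shEnt_congr_of_comp (Y := fun ω => (W ω, S ω)) (fun x => (x.1, x.1 + x.2))
      (fun x => (x.1, x.2 - x.1)) (by intros; simp only [hW, hS]; congr 1; abel)
      (by intros; simp only [hW, hS]; congr 1; abel)] at this
    linarith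
  have bST : t + shEnt P S ≤ shEnt P (fun ω => (U ω, S ω)) + shEnt P (fun ω => (U' ω, S ω)) :=
    shEnt_submodular hPs.1 (by simp +contextual) (by simp +contextual) (by simp +contextual)
  have bs₁ : h₂ + s₁ ≤ 2 * σ := by
    have e₁ := shEnt_pair_le hPs (fun ω => ((ω.1.1, ω.2.2), ω.2.1)) (fun ω => ω.1.2)
    rw [shEnt_congr_of_comp (Y := fun ω => ω) (fun x => ((x.1.1.1, x.2), (x.1.2, x.1.1.2)))
      (fun x => (((x.1.1, x.2.2), x.2.1), x.1.2)) (by simp) (by simp), hPid, hb'] at e₁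
    have e₂ := shEnt_pair_le hPs (fun ω => ω.1.1) (fun ω => ω.2.2)
    have e₃ := shEnt_pair_le hPs U U'
    have e₄ := shEnt_submodular hPs.1 (A := fun ω => (U ω, U' ω)) (B := fun ω => (ω.1.1, ω.2.2))
      (C := W) (D := fun ω => ((ω.1.1, ω.2.2), ω.2.1))
      (by
        intro ω ω' h h'
        simp only [hU, Prod.mk.injEq] at h h' ⊢
        exact ⟨h', add_left_cancel (h'.1 ▸ h.1)⟩)
      (by
        intro ω ω' h
        simp only [Prod.mk.injEq] at h
        rw [← hWU, ← hWU, h.1, h.2])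
      (by
        intro ω ω' h
        simp only [Prod.mk.injEq] at h
        simp only [hW, h.1, h.2])
    linarith
  have bs₂ : h₁ + s₂ ≤ 2 * σ := by
    have e₁ := shEnt_pair_le hPs (fun ω => ((ω.1.2, ω.2.1), ω.1.1)) (fun ω => ω.2.2)
    rw [shEnt_congr_of_comp (Y := fun ω => ω) (fun x => ((x.1.2, x.1.1.1), (x.1.1.2, x.2)))
      (fun x => (((x.1.2, x.2.1), x.1.1), x.2.2)) (by simp) (by simp), hPid, ha'] at e₁
    have e₂ := shEnt_pair_le hPs (fun ω => ω.1.2) (fun ω => ω.2.1)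
    have e₃ := shEnt_pair_le hPs U (fun ω => ω.1.1 + ω.1.2)
    have e₄ := shEnt_submodular hPs.1 (A := fun ω => (U ω, ω.1.1 + ω.1.2))
      (B := fun ω => (ω.1.2, ω.2.1)) (C := fun ω => ω.1.2 + ω.2.1)
      (D := fun ω => ((ω.1.2, ω.2.1), ω.1.1))
      (by
        intro ω ω' h h'
        simp only [hU, Prod.mk.injEq] at h h' ⊢
        exact ⟨h', add_right_cancel (h'.2 ▸ h.1)⟩)
      (by
        intro ω ω' h
        simp only [hU, Prod.mk.injEq] at h
        have h1 : ∀ ω : (V × V) × (V × V), ω.1.2 + ω.2.1 = (ω.1.1 + ω.2.1) + (ω.1.1 + ω.1.2) :=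
          fun ω => by linear_combination (norm := module) - hz ω.1.1
        rw [h1, h1, h.1, h.2])
      (by
        intro ω ω' h
        simp only [Prod.mk.injEq] at h
        simp only [h.1, h.2])
    linarith
  have bs : s₁ + s₂ ≤ 2 * σ + 6 / 50 * (σ - h₁ / 2 - h₂ / 2) := by
    let e : (V × V) × (V × V) ≃ (V × V) × (V × V) :=
      { toFun := fun ω => ((ω.1.1, ω.2.2), (ω.1.2, ω.2.1))
        invFun := fun ω => ((ω.1.1, ω.2.1), (ω.2.2, ω.1.2))
        left_inv := fun _ => rfl
        right_inv := fun _ => rfl }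
    have he : law P e = prodW (prodW v v) (prodW w w) := by
      rw [law_equiv]
      ext ω
      simp only [hP, prodW, e, Equiv.coe_fn_symm_mk]
      ring
    have hQs := prodW_mem_stdSimplex hvv hww
    have hsum : shEnt (prodW (prodW v v) (prodW w w))
        (fun ω => ((ω.1.1 + ω.1.2) + (ω.2.1 + ω.2.2), ())) = shEnt P S := by
      rw [← he, shEnt_law]
      refine shEnt_congr_of_comp (fun x => x.1) (fun x => (x, ())) ?_ ?_ <;> intros <;>
        simp only [e, hS, Equiv.coe_fn_mk] <;> abel_nf
    have := tau_le_of_condIndep hq hmin hQs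
      (condIndep_prodW_const hvv hww (fun x => x.1 + x.2) (fun x => x.1 + x.2))
    rw [condDist_const hQs (fun ω => ω.1.1 + ω.1.2), condDist_const hQs (fun ω => ω.2.1 + ω.2.2),
      shEnt_const hQs.2, hsum,
      shEnt_pair_unit (prodW (prodW v v) (prodW w w)) (fun ω => ω.1.1 + ω.1.2),
      shEnt_pair_unit (prodW (prodW v v) (prodW w w)) (fun ω => ω.2.1 + ω.2.2),
      law_prodW_fst (prodW v v) hww.2 (fun x => x.1 + x.2),
      law_prodW_snd hvv.2 (prodW w w) (fun x => x.1 + x.2),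
      shEnt_prodW_fst (prodW v v) hww.2 (fun x => x.1 + x.2),
      shEnt_prodW_snd hvv.2 (prodW w w) (fun x => x.1 + x.2)] at this
    linarith
  have key := tau_le_of_fibre hq (by norm_num) hmin hPs U U' S
  simp only [hWU] at key
  rw [show law P U = L from lab, show law P U' = L from lba', show shEnt P U = σ from hab,
    show shEnt P U' = σ from hba'] at key
  linarith

end Fibring

section Subspace

variable {V T : Type*} [Fintype T] [AddCommGroup V] [Fintype V]

theorem law_prodW_add (v w : V → ℝ) (s : V) :
    law (prodW v w) (fun x => x.1 + x.2) s = ∑ y, w y * v (s - y) := by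
  classical
  simp only [law, prodW, Fintype.sum_prod_type]
  rw [Finset.sum_comm]
  refine Finset.sum_congr rfl fun y _ => ?_
  rw [Finset.sum_eq_single (s - y) (fun x _ hx => if_neg fun h => hx (eq_sub_of_add_eq h))
    (by simp)]
  simp [mul_comm]

/-- If adding an independent variable does not increase entropy, then the support of
that variable lies in a coset of the stabiliser of the law. -/
theorem eq_of_shEnt_add_le {v w : V → ℝ} (hv : v ∈ stdSimplex ℝ V) (hw : w ∈ stdSimplex ℝ V)
    (h : shEnt (prodW v w) (fun x => x.1 + x.2) ≤ shEnt v (fun x => x)) {y y' : V}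
    (hy : w y ≠ 0) (hy' : w y' ≠ 0) (x : V) : v (x + (y - y')) = v x := by
  have hle : ∀ s, ∑ y, w y * Real.negMulLog (v (s - y))
      ≤ Real.negMulLog (law (prodW v w) (fun x => x.1 + x.2) s) := by
    intro s
    rw [law_prodW_add]
    exact Real.concaveOn_negMulLog.le_map_sum (fun y _ => hw.1 y) hw.2 (fun y _ => hv.1 _)
  have hsum : ∑ s, ∑ y, w y * Real.negMulLog (v (s - y)) = shEnt v (fun x => x) := by
    rw [Finset.sum_comm, shEnt_id]
    simp only [← Finset.mul_sum]
    have : ∀ y, ∑ s, Real.negMulLog (v (s - y)) = ∑ s, Real.negMulLog (v s) := fun y =>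
      Equiv.sum_comp (Equiv.subRight y) (fun s => Real.negMulLog (v s))
    simp only [this, ← Finset.sum_mul, hw.2, one_mul]
  rw [shEnt_eq_sum_negMulLog, ← hsum] at h
  have heq := (Finset.sum_eq_sum_iff_of_le fun s _ => hle s).1
    (le_antisymm (Finset.sum_le_sum fun s _ => hle s) h)
  have key : ∀ s y, w y ≠ 0 → v (s - y) = law (prodW v w) (fun x => x.1 + x.2) s := by
    intro s y hy
    have h1 := (heq s (Finset.mem_univ s)).symm
    rw [law_prodW_add] at h1 ⊢
    exact (Real.strictConcaveOn_negMulLog.map_sum_eq_iff' (fun y _ => hw.1 y) hw.2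
      (fun y _ => hv.1 _)).1 h1 y (Finset.mem_univ y) hy
  have h1 := key (x + y) y hy
  have h2 := key (x + y) y' hy'
  rw [add_sub_cancel_right] at h1
  rw [add_sub_assoc] at h2
  rw [h1, h2]

theorem le_shEnt_add {v w : V → ℝ} (hv : v ∈ stdSimplex ℝ V) (hw : w ∈ stdSimplex ℝ V) :
    shEnt v (fun x => x) ≤ shEnt (prodW v w) (fun x => x.1 + x.2) ∧
    shEnt w (fun x => x) ≤ shEnt (prodW v w) (fun x => x.1 + x.2) := by
  have hvw := prodW_mem_stdSimplex hv hw
  have h1 := shEnt_submodular hvw.1 (A := fun ω => ω.1 + ω.2) (B := fun ω => ω.1)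
    (C := fun _ => ()) (D := fun ω => (ω.1, ω.2))
    (by
      intro ω ω' h h'
      exact Prod.ext h' (add_left_cancel (h' ▸ h)))
    (by simp) (by simp)
  have h2 := shEnt_submodular hvw.1 (A := fun ω => ω.1 + ω.2) (B := fun ω => ω.2)
    (C := fun _ => ()) (D := fun ω => (ω.1, ω.2))
    (by
      intro ω ω' h h'
      exact Prod.ext (add_right_cancel (h' ▸ h)) h')
    (by simp) (by simp)
  rw [shEnt_const hvw.2, shEnt_prodW_map hv hw (fun x => x) (fun x => x)] at h1 h2
  rw [shEnt_prodW_fst v hw.2 (fun x => x)] at h1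
  rw [shEnt_prodW_snd hv.2 w (fun x => x)] at h2
  constructor <;> linarith

/-- The doubling entropy of the first component of `q` given its second component. -/
noncomputable def condDoubling (q : V × T → ℝ) : ℝ :=
  shEnt (prodW q q) (fun ω => (ω.1.1 + ω.2.1, (ω.1.2, ω.2.2))) - 2 * shEnt q Prod.snd
    - (shEnt q (fun x => x) - shEnt q Prod.snd)

theorem condDoubling_nonneg {q : V × T → ℝ} (hq : q ∈ stdSimplex ℝ (V × T)) :
    0 ≤ condDoubling q := by
  have hqq := prodW_mem_stdSimplex hq hq
  have h := shEnt_submodular hqq.1 (A := fun ω => (ω.1.1 + ω.2.1, (ω.1.2, ω.2.2)))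
    (B := fun ω => ω.2) (C := fun ω => ω.2.2) (D := fun ω => (ω.1, ω.2))
    (by
      rintro ⟨⟨a, b⟩, c, d⟩ ⟨⟨a', b'⟩, c', d'⟩ h h'
      simp only [Prod.mk.injEq] at h h' ⊢
      obtain ⟨rfl, rfl⟩ := h'
      exact ⟨⟨add_right_cancel h.1, h.2.1⟩, rfl, rfl⟩)
    (by
      intro ω ω' h
      simp only [Prod.mk.injEq] at h
      exact h.2.2)
    (by
      intro ω ω' h
      rw [h])
  rw [shEnt_prodW_map hq hq (fun x => x) (fun x => x), shEnt_prodW_snd hq.2 q (fun x => x),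
    shEnt_prodW_snd hq.2 q (fun x => x.2)] at h
  change _ + shEnt q Prod.snd ≤ _ at h
  rw [condDoubling]
  linarith

theorem tau_min_le_condDoubling {η τ₀ : ℝ} (hη : 0 ≤ η) {q : V × T → ℝ}
    (hq : q ∈ stdSimplex ℝ (V × T))
    (hmin : ∀ v ∈ stdSimplex ℝ V, ∀ w ∈ stdSimplex ℝ V, τ₀ ≤ tau η q v w) :
    τ₀ ≤ (1 + 2 * η) * condDoubling q := by
  have hqq := prodW_mem_stdSimplex hq hq
  have hqqq := prodW_mem_stdSimplex hqq hq
  have hmain := tau_le_of_condIndep hq hmin hqq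
    (condIndep_prodW hq.1 hq.1 (fun x => x.1) (fun x => x.2) (fun x => x.1) (fun x => x.2))
  have eC : shEnt (prodW q q) (fun ω => (ω.1.2, ω.2.2)) = shEnt q Prod.snd + shEnt q Prod.snd :=
    shEnt_prodW_map hq hq (fun x => x.2) (fun x => x.2)
  have eA : shEnt (prodW q q) (fun ω => (ω.1.1, (ω.1.2, ω.2.2)))
      = shEnt q (fun x => x) + shEnt q Prod.snd := by
    rw [← shEnt_prodW_map hq hq (fun x => x) Prod.snd]
    exact shEnt_congr_of_comp (fun x => ((x.1, x.2.1), x.2.2))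
      (fun x => (x.1.1, (x.1.2, x.2))) (by simp) (by simp)
  have eB : shEnt (prodW q q) (fun ω => (ω.2.1, (ω.1.2, ω.2.2)))
      = shEnt q Prod.snd + shEnt q (fun x => x) := by
    rw [← shEnt_prodW_map hq hq Prod.snd (fun x => x)]
    exact shEnt_congr_of_comp (fun x => (x.2.1, (x.1, x.2.2)))
      (fun x => (x.2.1, (x.1, x.2.2))) (by simp) (by simp)
  have dA : condDist q (prodW q q) (fun ω => ω.1.1) (fun ω => (ω.1.2, ω.2.2))
      ≤ condDoubling q := by
    have h1 := shEnt_pair_le hqqq (fun ω => (ω.1.1.1 + ω.2.1, (ω.1.1.2, ω.2.2)))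
      (fun ω => ω.1.2.2)
    rw [shEnt_prodW_fst (prodW q q) hq.2 (fun ω => ω.2.2), shEnt_prodW_snd hq.2 q (fun x => x.2),
      ← shEnt_law (prodW (prodW q q) q) (fun ω => (ω.1.1, ω.2))
        (fun ω => (ω.1.1 + ω.2.1, (ω.1.2, ω.2.2))),
      law_prodW_map (prodW q q) q (fun ω => ω.1) (fun x => x),
      law_prodW_fst q hq.2 (fun x => x), law_id] at h1
    rw [shEnt_congr_of_comp (Y := fun ω => ((ω.1.1.1 + ω.2.1, ω.2.2), (ω.1.1.2, ω.1.2.2)))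
      (fun x => ((x.1.1, x.1.2.2), (x.1.2.1, x.2)))
      (fun x => ((x.1.1, (x.2.1, x.1.2)), x.2.2)) (by simp) (by simp)] at h1
    rw [condDist, eC, eA, condDoubling]
    change _ ≤ _ + shEnt q Prod.snd at h1
    linarith
  have dB : condDist q (prodW q q) (fun ω => ω.2.1) (fun ω => (ω.1.2, ω.2.2))
      ≤ condDoubling q := by
    have h1 := shEnt_pair_le hqqq (fun ω => (ω.1.2.1 + ω.2.1, (ω.1.2.2, ω.2.2)))
      (fun ω => ω.1.1.2)
    rw [shEnt_prodW_fst (prodW q q) hq.2 (fun ω => ω.1.2), shEnt_prodW_fst q hq.2 (fun x => x.2),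
      ← shEnt_law (prodW (prodW q q) q) (fun ω => (ω.1.2, ω.2))
        (fun ω => (ω.1.1 + ω.2.1, (ω.1.2, ω.2.2))),
      law_prodW_map (prodW q q) q (fun ω => ω.2) (fun x => x),
      law_prodW_snd hq.2 q (fun x => x), law_id] at h1
    rw [shEnt_congr_of_comp (Y := fun ω => ((ω.1.2.1 + ω.2.1, ω.2.2), (ω.1.1.2, ω.1.2.2)))
      (fun x => ((x.1.1, x.1.2.2), (x.2, x.1.2.1)))
      (fun x => ((x.1.1, (x.2.2, x.1.2)), x.2.1)) (by simp) (by simp)] at h1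
    rw [condDist, eC, eB, condDoubling]
    change _ ≤ _ + shEnt q Prod.snd at h1
    linarith
  have d := mul_le_mul_of_nonneg_left (add_le_add dA dB) hη
  rw [eC, eA, eB] at hmain
  have : (1 + 2 * η) * condDoubling q = condDoubling q + η * (condDoubling q + condDoubling q) := by
    ring
  rw [this]
  unfold condDoubling at d ⊢
  linarith

variable [Module (ZMod 2) V]

/-- The submodule of translations preserving `v`. -/
def stabilizer (v : V → ℝ) : Submodule (ZMod 2) V where
  carrier := {h | ∀ x, v (x + h) = v x}
  zero_mem' := by simp
  add_mem' := by
    intro a b ha hb x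
    rw [← add_assoc, hb, ha]
  smul_mem' := by
    intro c h hh x
    obtain rfl | rfl : c = 0 ∨ c = 1 := by revert c; decide
    · simp
    · simpa using hh x

theorem log_card_stabilizer_le {v : V → ℝ} (hv : v ∈ stdSimplex ℝ V) :
    Real.log (Nat.card (stabilizer v)) ≤ shEnt v (fun x => x) := by
  classical
  have hpos : (0 : ℝ) < Nat.card (stabilizer v) := by exact_mod_cast Nat.card_pos
  have hle : ∀ x, Nat.card (stabilizer v) * v x ≤ 1 := by
    intro x
    rw [Nat.card_eq_fintype_card, ← nsmul_eq_mul, ← Finset.card_univ, ← Finset.sum_const,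
      ← hv.2]
    calc ∑ _h : stabilizer v, v x = ∑ h : stabilizer v, v (x + h) :=
          Finset.sum_congr rfl fun h _ => (h.2 x).symm
      _ = ∑ y ∈ Finset.univ.image fun h : stabilizer v => x + h, v y := by
          rw [Finset.sum_image]
          intro a _ b _ hab
          exact Subtype.ext (add_left_cancel hab)
      _ ≤ ∑ y, v y := Finset.sum_le_univ_sum_of_nonneg hv.1
  rw [shEnt, law_id, ← Finset.sum_neg_distrib]
  calc Real.log (Nat.card (stabilizer v)) = ∑ x, v x * Real.log (Nat.card (stabilizer v)) := by
        rw [← Finset.sum_mul, hv.2, one_mul]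
    _ ≤ _ := Finset.sum_le_sum fun x _ => ?_
  rcases (hv.1 x).eq_or_lt with h0 | h0
  · simp [← h0]
  · rw [← mul_neg, ← Real.log_inv]
    refine mul_le_mul_of_nonneg_left (Real.log_le_log hpos ?_) h0.le
    rw [← one_div, le_div_iff₀ h0]
    exact hle x

theorem shEnt_mkQ_le_refDist {q : V × T → ℝ} (hq : q ∈ stdSimplex ℝ (V × T)) {w : V → ℝ}
    (hw : w ∈ stdSimplex ℝ V) (U : Submodule (ZMod 2) V)
    (hU : ∀ y y', w y ≠ 0 → w y' ≠ 0 → y - y' ∈ U) :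
    2 * (shEnt q (fun x => (U.mkQ x.1, x.2)) - shEnt q Prod.snd) + shEnt w (fun x => x)
      - (shEnt q (fun x => x) - shEnt q Prod.snd) ≤ 2 * refDist q w := by
  have hpq := prodW_mem_stdSimplex hw hq
  have hU' : ∀ y y', w y ≠ 0 → w y' ≠ 0 → U.mkQ y = U.mkQ y' := fun y y' h h' =>
    (Submodule.Quotient.eq U).2 (hU y y' h h')
  have h1 := shEnt_submodular hpq.1 (A := fun ω => (ω.1 + ω.2.1, ω.2.2))
    (B := fun ω => (U.mkQ ω.1, ω.2)) (C := fun ω => (U.mkQ (ω.1 + ω.2.1), ω.2.2))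
    (D := fun ω => (ω.1, ω.2))
    (by
      intro ω ω' h h'
      simp only [Prod.mk.injEq] at h h' ⊢
      exact ⟨add_right_cancel (h'.2 ▸ h.1), h'.2⟩)
    (by
      intro ω ω' h
      simp only [Prod.mk.injEq] at h ⊢
      rw [h.1]
      exact ⟨rfl, h.2⟩)
    (by
      intro ω ω' h
      simp only [Prod.mk.injEq] at h ⊢
      rw [map_add, map_add, h.1, h.2]
      exact ⟨rfl, rfl⟩)
  have hB : shEnt (prodW w q) (fun ω => (U.mkQ ω.1, ω.2)) = shEnt q (fun x => x) := by
    rw [← shEnt_prodW_snd hw.2 q (fun x => x)]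
    refine shEnt_congr fun ω ω' h h' => ?_
    simp [hU' _ _ (left_ne_zero_of_mul h) (left_ne_zero_of_mul h')]
  have hC : shEnt (prodW w q) (fun ω => (U.mkQ (ω.1 + ω.2.1), ω.2.2))
      = shEnt q (fun x => (U.mkQ x.1, x.2)) := by
    rw [← shEnt_prodW_snd hw.2 q (fun x => (U.mkQ x.1, x.2))]
    refine shEnt_congr fun ω ω' h h' => ?_
    simp only [Prod.mk.injEq, map_add,
      hU' _ _ (left_ne_zero_of_mul h) (left_ne_zero_of_mul h'), add_right_inj]
  rw [hB, hC, shEnt_prodW_map hw hq (fun x => x) (fun x => x)] at h1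
  unfold refDist
  linarith

/-- A conditional entropic Freiman-type theorem in characteristic two. -/
theorem exists_submodule_le_condDoubling {q : V × T → ℝ} (hq : q ∈ stdSimplex ℝ (V × T)) :
    ∃ U : Submodule (ZMod 2) V,
      2 * (shEnt q (fun x => (U.mkQ x.1, x.2)) - shEnt q Prod.snd) + Real.log (Nat.card U)
        - (shEnt q (fun x => x) - shEnt q Prod.snd) ≤ 104 * condDoubling q := by
  obtain ⟨v, hv, w, hw, hmin⟩ := exists_tau_minimizer (1 / 50) q
  have h0 := shEnt_add_le_of_tau_minimizer hq hv hw hmin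
  obtain ⟨h1, h2⟩ := le_shEnt_add hv hw
  have h3 := tau_min_le_condDoubling (by norm_num) hq hmin
  have h4 := shEnt_mkQ_le_refDist hq hw (stabilizer v)
    (fun y y' hy hy' => eq_of_shEnt_add_le hv hw (by linarith) hy hy')
  have h5 := log_card_stabilizer_le hv
  have h6 := refDist_nonneg hq hv
  refine ⟨stabilizer v, ?_⟩
  unfold tau at h3
  linarith

end Subspace

section Quotient

variable {E : Type*} [AddCommGroup E] [Fintype E] [Module (ZMod 2) E]

/-- Twice the entropy of the image in `E ⧸ K`, plus the entropy of the uniform law on `K`. -/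
noncomputable def quotEnt (p : E → ℝ) (K : Submodule (ZMod 2) E) : ℝ :=
  2 * shEnt p K.mkQ + Real.log (Nat.card K)

theorem log_card_submodule (K : Submodule (ZMod 2) E) :
    Real.log (Nat.card K) = Module.finrank (ZMod 2) K * Real.log 2 := by
  rw [Module.natCard_eq_pow_finrank (K := ZMod 2), Nat.card_zmod]
  push_cast
  rw [Real.log_pow]

theorem mkQ_eq_mkQ_iff {E : Type*} [AddCommGroup E] [Module (ZMod 2) E]
    {K : Submodule (ZMod 2) E} {a b : E} : K.mkQ a = K.mkQ b ↔ a - b ∈ K :=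
  Submodule.Quotient.eq K

theorem quotEnt_submodular {p : E → ℝ} (hp : p ∈ stdSimplex ℝ E) (K L : Submodule (ZMod 2) E) :
    quotEnt p (K ⊓ L) + quotEnt p (K ⊔ L) ≤ quotEnt p K + quotEnt p L := by
  have h1 := shEnt_submodular hp.1 (A := K.mkQ) (B := L.mkQ) (C := (K ⊔ L).mkQ)
    (D := (K ⊓ L).mkQ)
    (by
      intro a b h h'
      rw [mkQ_eq_mkQ_iff] at *
      exact ⟨h, h'⟩)
    (by
      intro a b h
      rw [mkQ_eq_mkQ_iff] at *
      exact Submodule.mem_sup_left h)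
    (by
      intro a b h
      rw [mkQ_eq_mkQ_iff] at *
      exact Submodule.mem_sup_right h)
  have h2 : (Module.finrank (ZMod 2) ↥(K ⊔ L) + Module.finrank (ZMod 2) ↥(K ⊓ L) : ℝ)
      = Module.finrank (ZMod 2) K + Module.finrank (ZMod 2) L := by
    exact_mod_cast Submodule.finrank_sup_add_finrank_inf_eq K L
  simp only [quotEnt, log_card_submodule]
  linear_combination 2 * h1 + Real.log 2 * h2

theorem quotEnt_comap {p : E → ℝ} (e : E ≃ₗ[ZMod 2] E) (he : law p e = p)
    (K : Submodule (ZMod 2) E) : quotEnt p (K.comap e.toLinearMap) = quotEnt p K := by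
  have h1 : shEnt p (K.comap e.toLinearMap).mkQ = shEnt p K.mkQ := by
    conv_rhs => rw [← he, shEnt_law]
    refine shEnt_congr fun a b _ _ => ?_
    simp only [mkQ_eq_mkQ_iff, Submodule.mem_comap, map_sub, LinearEquiv.coe_coe]
  have h2 : Nat.card (K.comap e.toLinearMap) = Nat.card K :=
    Nat.card_congr (e.toEquiv.subtypeEquiv fun a => by simp)
  rw [quotEnt, quotEnt, h1, h2]

/-- If every intermediate submodule invariant under a family of law-preserving automorphisms is
trivial, then `quotEnt` on the interval is minimised at one of the endpoints. -/
theorem min_quotEnt_le {p : E → ℝ} (hp : p ∈ stdSimplex ℝ E) {K₀ K₁ : Submodule (ZMod 2) E}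
    (S : Set (E ≃ₗ[ZMod 2] E)) (hS : ∀ e ∈ S, law p e = p)
    (h₀ : ∀ e ∈ S, ∀ z ∈ K₀, e z ∈ K₀) (h₁ : ∀ e ∈ S, ∀ z, e z ∈ K₁ → z ∈ K₁)
    (hirr : ∀ K, K₀ ≤ K → K ≤ K₁ → (∀ e ∈ S, ∀ z ∈ K, e z ∈ K) → K = K₀ ∨ K = K₁)
    {K : Submodule (ZMod 2) E} (hK₀ : K₀ ≤ K) (hK₁ : K ≤ K₁) :
    min (quotEnt p K₀) (quotEnt p K₁) ≤ quotEnt p K := by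
  obtain ⟨M, hM, hMmin⟩ := Set.exists_min_image (Set.Icc K₀ K₁) (quotEnt p) (Set.toFinite _)
    ⟨K, hK₀, hK₁⟩
  obtain ⟨L, ⟨hL, hLM⟩, hLmin⟩ := Set.exists_min_image
    {L | L ∈ Set.Icc K₀ K₁ ∧ quotEnt p L = quotEnt p M} (fun L => Module.finrank (ZMod 2) L)
    (Set.toFinite _)
    ⟨M, hM, rfl⟩
  have hinv : ∀ e ∈ S, ∀ z ∈ L, e z ∈ L := by
    intro e he
    have hc : L.comap e.toLinearMap ∈ Set.Icc K₀ K₁ :=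
      ⟨fun z hz => hL.1 (h₀ e he z hz), fun z hz => h₁ e he z (hL.2 hz)⟩
    have hsub := quotEnt_submodular hp L (L.comap e.toLinearMap)
    rw [quotEnt_comap e (hS e he)] at hsub
    have hinf : L ⊓ L.comap e.toLinearMap ∈ Set.Icc K₀ K₁ :=
      ⟨le_inf hL.1 hc.1, inf_le_left.trans hL.2⟩
    have hsup : L ⊔ L.comap e.toLinearMap ∈ Set.Icc K₀ K₁ :=
      ⟨hL.1.trans le_sup_left, sup_le hL.2 hc.2⟩
    have hcard := hLmin (L ⊓ L.comap e.toLinearMap)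
      ⟨hinf, le_antisymm (by linarith [hMmin _ hsup]) (hMmin _ hinf)⟩
    have heq := Submodule.eq_of_le_of_finrank_le inf_le_left hcard
    exact fun z hz => (inf_eq_left.1 heq) hz
  have hfin := hMmin K ⟨hK₀, hK₁⟩
  rcases hirr L hL.1 hL.2 hinv with rfl | rfl
  · exact (min_le_left _ _).trans (hLM.trans_le hfin)
  · exact (min_le_right _ _).trans (hLM.trans_le hfin)

theorem log_card_map_add_log_card_inf_ker {F : Type*} [AddCommGroup F] [Fintype F]
    [Module (ZMod 2) F] (f : E →ₗ[ZMod 2] F) (A : Submodule (ZMod 2) E) :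
    Real.log (Nat.card (A.map f)) + Real.log (Nat.card ↥(A ⊓ LinearMap.ker f))
      = Real.log (Nat.card A) := by
  have h := (f.domRestrict A).finrank_range_add_finrank_ker
  rw [LinearMap.range_domRestrict, LinearMap.ker_domRestrict,
    ← Submodule.finrank_map_subtype_eq, Submodule.map_comap_subtype] at h
  simp only [log_card_submodule, ← h]
  push_cast
  ring

end Quotient

end FinEntropy

section Transform

variable {m : ℕ}

theorem Gmat_apply_pair {i j : Fin m} (hij : i ≠ j) (y x : Idx m) :
    Gmat m y x = base (y i) (x i) * (base (y j) (x j)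
      * ∏ k ∈ (Finset.univ.erase i).erase j, base (y k) (x k)) := by
  rw [Gmat, ← Finset.mul_prod_erase _ _ (Finset.mem_univ i),
    ← Finset.mul_prod_erase _ _ (Finset.mem_erase.2 ⟨hij.symm, Finset.mem_univ j⟩)]

/-- The transvection `x i ↦ x i + x j` of the index set. -/
def shear (i j : Fin m) (x : Idx m) : Idx m := Function.update x i (x i + x j)

theorem shear_apply_self (i j : Fin m) (x : Idx m) : shear i j x i = x i + x j := by
  simp [shear]

theorem shear_apply_of_ne {i j k : Fin m} (hk : k ≠ i) (x : Idx m) : shear i j x k = x k := by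
  simp [shear, hk]

theorem shear_involutive {i j : Fin m} (hij : i ≠ j) : Function.Involutive (shear i j) := by
  intro x
  ext k
  by_cases hk : k = i
  · subst hk
    rw [shear_apply_self, shear_apply_self, shear_apply_of_ne hij.symm, add_assoc,
      CharTwo.add_self_eq_zero, add_zero]
  · rw [shear_apply_of_ne hk, shear_apply_of_ne hk]

theorem Gmat_shear {i j : Fin m} (hij : i ≠ j) (y x : Idx m) :
    Gmat m y (shear i j x) = Gmat m y x + if y i = 0 ∧ y j = 1 then
      Gmat m (y ∘ Equiv.swap i j) x + Gmat m (Function.update y i 1) x else 0 := by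
  have key : ∀ a b c d g : ZMod 2, base a (c + d) * (base b d * g)
      = base a c * (base b d * g) + if a = 0 ∧ b = 1 then
        base b c * (base a d * g) + base 1 c * (base b d * g) else 0 := by decide
  have h1 : ∏ k ∈ (Finset.univ.erase i).erase j, base (y k) (shear i j x k)
      = ∏ k ∈ (Finset.univ.erase i).erase j, base (y k) (x k) :=
    Finset.prod_congr rfl fun k hk => by
      rw [shear_apply_of_ne (Finset.mem_erase.1 (Finset.mem_erase.1 hk).2).1]
  have h2 : ∏ k ∈ (Finset.univ.erase i).erase j, base (y (Equiv.swap i j k)) (x k)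
      = ∏ k ∈ (Finset.univ.erase i).erase j, base (y k) (x k) :=
    Finset.prod_congr rfl fun k hk => by
      simp only [Finset.mem_erase] at hk
      rw [Equiv.swap_apply_of_ne_of_ne hk.2.1 hk.1]
  have h3 : ∏ k ∈ (Finset.univ.erase i).erase j, base (Function.update y i 1 k) (x k)
      = ∏ k ∈ (Finset.univ.erase i).erase j, base (y k) (x k) :=
    Finset.prod_congr rfl fun k hk => by
      simp only [Finset.mem_erase] at hk
      rw [Function.update_of_ne hk.2.1]
  simp only [Gmat_apply_pair hij, h1, h2, h3, shear_apply_self, shear_apply_of_ne hij.symm,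
    Function.comp_apply, Equiv.swap_apply_left, Equiv.swap_apply_right, Function.update_self,
    Function.update_of_ne hij.symm]
  exact key _ _ _ _ _

/-- Precomposition with a transvection, acting on noise vectors. -/
def shearEquiv {i j : Fin m} (hij : i ≠ j) : (Idx m → ZMod 2) ≃ₗ[ZMod 2] (Idx m → ZMod 2) :=
  LinearEquiv.funCongrLeft (ZMod 2) (ZMod 2) (shear_involutive hij).toPerm

theorem shearEquiv_apply {i j : Fin m} (hij : i ≠ j) (z : Idx m → ZMod 2) (x : Idx m) :
    shearEquiv hij z x = z (shear i j x) := rfl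

theorem shearEquiv_shearEquiv {i j : Fin m} (hij : i ≠ j) (z : Idx m → ZMod 2) :
    shearEquiv hij (shearEquiv hij z) = z := by
  ext x
  rw [shearEquiv_apply, shearEquiv_apply, shear_involutive hij]

theorem Wfun_shearEquiv {i j : Fin m} (hij : i ≠ j) (z : Idx m → ZMod 2) (y : Idx m) :
    Wfun m (shearEquiv hij z) y = Wfun m z y + if y i = 0 ∧ y j = 1 then
      Wfun m z (y ∘ Equiv.swap i j) + Wfun m z (Function.update y i 1) else 0 := by
  have h : Wfun m (shearEquiv hij z) y = ∑ x, Gmat m y (shear i j x) * z x := by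
    rw [← Equiv.sum_comp (shear_involutive hij).toPerm]
    simp only [Function.Involutive.coe_toPerm, shear_involutive hij _]
    rfl
  rw [h]
  simp only [Gmat_shear hij, add_mul, Finset.sum_add_distrib, ite_mul, zero_mul]
  congr 1
  split_ifs
  · simp only [Finset.sum_add_distrib]
    rfl
  · simp

theorem wt_comp_equiv (y : Idx m) (e : Equiv.Perm (Fin m)) : wt (y ∘ e) = wt y := by
  refine Finset.card_equiv e fun k => ?_
  simp

theorem wt_update_one {y : Idx m} {i : Fin m} (hi : y i = 0) :
    wt (Function.update y i 1) = wt y + 1 := by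
  have : (Finset.univ.filter fun k => Function.update y i 1 k = 1)
      = insert i (Finset.univ.filter fun k => y k = 1) := by
    ext k
    by_cases hk : k = i
    · simp [hk]
    · simp [hk]
  rw [wt, this, Finset.card_insert_of_notMem (by simp [hi]), wt]

theorem Gmat_mul_self : Gmat m * Gmat m = 1 := by
  ext x y
  rw [Matrix.mul_apply]
  simp only [Gmat, ← Finset.prod_mul_distrib]
  rw [← Fintype.prod_sum (fun i c => base (x i) c * base c (y i))]
  have key : ∀ a b : ZMod 2, ∑ c, base a c * base c b = if a = b then 1 else 0 := by decide
  simp only [key, Matrix.one_apply]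
  split_ifs with h
  · simp [h]
  · obtain ⟨i, hi⟩ := Function.ne_iff.1 h
    exact Finset.prod_eq_zero (Finset.mem_univ i) (if_neg hi)

theorem Wfun_Wfun (z : Idx m → ZMod 2) : Wfun m (Wfun m z) = z := by
  rw [Wfun, Wfun, Matrix.mulVec_mulVec, Gmat_mul_self, Matrix.one_mulVec]

theorem Wfun_add (z z' : Idx m → ZMod 2) : Wfun m (z + z') = Wfun m z + Wfun m z' :=
  Matrix.mulVec_add _ _ _

theorem Wfun_smul (c : ZMod 2) (z : Idx m → ZMod 2) : Wfun m (c • z) = c • Wfun m z :=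
  Matrix.mulVec_smul _ _ _

theorem card_wt_eq (m r : ℕ) : Fintype.card {x : Idx m // wt x = r} = m.choose r := by
  classical
  rw [Fintype.card_subtype, ← Finset.card_fin m, ← Finset.card_powersetCard, Finset.card_fin]
  refine Finset.card_bij' (fun x _ => Finset.univ.filter fun i => x i = 1)
    (fun s _ i => if i ∈ s then 1 else 0) ?_ ?_ ?_ ?_
  · intro x hx
    simpa [Finset.mem_powersetCard, wt] using (Finset.mem_filter.1 hx).2
  · intro s hs
    refine Finset.mem_filter.2 ⟨Finset.mem_univ _, ?_⟩
    simpa [Finset.mem_powersetCard, wt] using hs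
  · intro x _
    have key : ∀ a : ZMod 2, (if a = 1 then 1 else 0) = a := by decide
    ext i
    simp [key]
  · intro s _
    ext i
    simp

/-- The noise vectors whose transform vanishes at every index of weight at least `s`. -/
def wtKer (m s : ℕ) : Submodule (ZMod 2) (Idx m → ZMod 2) where
  carrier := {z | ∀ y, s ≤ wt y → Wfun m z y = 0}
  zero_mem' := fun y _ => by simp [Wfun]
  add_mem' := fun ha hb y hy => by rw [Wfun_add, Pi.add_apply, ha y hy, hb y hy, add_zero]
  smul_mem' := fun c z hz y hy => by rw [Wfun_smul, Pi.smul_apply, hz y hy, smul_zero]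

theorem mem_wtKer {s : ℕ} {z : Idx m → ZMod 2} :
    z ∈ wtKer m s ↔ ∀ y, s ≤ wt y → Wfun m z y = 0 := Iff.rfl

theorem shearEquiv_mem_wtKer {s : ℕ} {i j : Fin m} (hij : i ≠ j) {z : Idx m → ZMod 2}
    (hz : z ∈ wtKer m s) : shearEquiv hij z ∈ wtKer m s := by
  intro y hy
  rw [Wfun_shearEquiv, hz y hy, zero_add]
  split_ifs with h
  · rw [hz _ (hy.trans (wt_comp_equiv y _).ge),
      hz _ (hy.trans ((Nat.le_succ _).trans (wt_update_one h.1).ge)), add_zero]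
  · rfl

theorem Wfun_add_shearEquiv {r : ℕ} {i j : Fin m} (hij : i ≠ j) {z : Idx m → ZMod 2}
    (hz : z ∈ wtKer m (r + 1)) {y : Idx m} (hy : wt y = r) :
    Wfun m (z + shearEquiv hij z) y
      = if y i = 0 ∧ y j = 1 then Wfun m z (y ∘ Equiv.swap i j) else 0 := by
  rw [Wfun_add, Pi.add_apply, Wfun_shearEquiv, ← add_assoc, CharTwo.add_self_eq_zero, zero_add]
  split_ifs with h
  · rw [hz (Function.update y i 1) (by rw [wt_update_one h.1, hy]), add_zero]
  · rfl

theorem exists_exchange {x x' : Idx m} (hw : wt x = wt x') (hne : x ≠ x') :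
    ∃ i j, x i = 1 ∧ x' i = 0 ∧ x j = 0 ∧ x' j = 1 := by
  have h01 : ∀ a : ZMod 2, a ≠ 1 → a = 0 := by decide
  have key : ∀ x x' : Idx m, wt x = wt x' → x ≠ x' → ∃ i, x i = 1 ∧ x' i = 0 := by
    intro x x' hw hne
    by_contra! hcon
    have hsub : (Finset.univ.filter fun i => x i = 1) ⊆ Finset.univ.filter fun i => x' i = 1 := by
      intro i
      simp only [Finset.mem_filter, Finset.mem_univ, true_and]
      intro hi
      by_contra h
      exact hcon i hi (h01 _ h)
    have heq := Finset.eq_of_subset_of_card_le hsub hw.ge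
    refine hne (funext fun i => ?_)
    have hi := Finset.ext_iff.1 heq i
    simp only [Finset.mem_filter, Finset.mem_univ, true_and] at hi
    by_cases h : x i = 1
    · rw [h, hi.1 h]
    · rw [h01 _ h, h01 _ fun h' => h (hi.2 h')]
  obtain ⟨i, hi, hi'⟩ := key x x' hw hne
  obtain ⟨j, hj, hj'⟩ := key x' x hw.symm hne.symm
  exact ⟨i, j, hi, hi', hj', hj⟩

theorem comp_swap_comp_swap (x : Idx m) (i j : Fin m) :
    (x ∘ Equiv.swap i j) ∘ Equiv.swap i j = x := by
  ext k
  simp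

/-- A shear-invariant submodule that is nonzero in weight `r` contains a vector whose transform
is supported, in weight `r`, at a single index. -/
theorem exists_mem_single {r : ℕ} {K : Submodule (ZMod 2) (Idx m → ZMod 2)}
    (hK₁ : K ≤ wtKer m (r + 1))
    (hinv : ∀ (i j : Fin m) (hij : i ≠ j), ∀ z ∈ K, shearEquiv hij z ∈ K)
    (hne : ¬ K ≤ wtKer m r) :
    ∃ z ∈ K, ∃ x, wt x = r ∧ ∀ y, wt y = r → (Wfun m z y ≠ 0 ↔ y = x) := by
  classical
  let supp : (Idx m → ZMod 2) → Finset (Idx m) := fun z =>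
    Finset.univ.filter fun x => wt x = r ∧ Wfun m z x ≠ 0
  have hsupp : ∀ z x, x ∈ supp z ↔ wt x = r ∧ Wfun m z x ≠ 0 := fun z x => by simp [supp]
  have hex : ∃ z ∈ K, (supp z).Nonempty := by
    obtain ⟨z, hz, hz'⟩ := Set.not_subset.1 hne
    simp only [SetLike.mem_coe, mem_wtKer, not_forall] at hz'
    obtain ⟨y, hy, hy'⟩ := hz'
    refine ⟨z, hz, y, (hsupp z y).2 ⟨?_, hy'⟩⟩
    by_contra h
    exact hy' (hK₁ hz y (by omega))
  obtain ⟨z, ⟨hzK, x, hx⟩, hmin⟩ := Set.exists_min_image {z | z ∈ K ∧ (supp z).Nonempty}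
    (fun z => (supp z).card) (Set.toFinite _) hex
  have hx' := (hsupp z x).1 hx
  refine ⟨z, hzK, x, hx'.1, fun y hy => ⟨fun hy' => ?_, fun h => h ▸ hx'.2⟩⟩
  by_contra hyx
  obtain ⟨i, j, hxi, hyi, hxj, hyj⟩ := exists_exchange (hx'.1.trans hy.symm) (Ne.symm hyx)
  have hij : i ≠ j := by
    rintro rfl
    exact zero_ne_one (hxj.symm.trans hxi)
  have hW : ∀ u, wt u = r → _ := fun u hu => Wfun_add_shearEquiv hij (hK₁ hzK) hu
  have hlt : (supp (z + shearEquiv hij z)).card < (supp z).card := by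
    refine (Finset.card_le_card_of_injOn (t := (supp z).erase y) (fun u => u ∘ Equiv.swap i j)
      ?_ ?_).trans_lt (Finset.card_erase_lt_of_mem ((hsupp z y).2 ⟨hy, hy'⟩))
    · intro u hu
      obtain ⟨hu, hu'⟩ := (hsupp _ u).1 hu
      rw [hW u hu] at hu'
      have hc : u i = 0 ∧ u j = 1 := by
        by_contra h
        exact hu' (if_neg h)
      rw [if_pos hc] at hu'
      refine Finset.mem_erase.2 ⟨fun h => ?_, (hsupp z _).2 ⟨(wt_comp_equiv u _).trans hu, hu'⟩⟩
      have := congr_fun h i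
      simp only at this
      rw [Function.comp_apply, Equiv.swap_apply_left, hc.2, hyi] at this
      exact one_ne_zero this
    · intro u _ v _ huv
      have := congr_arg (fun w => w ∘ Equiv.swap i j) huv
      simpa only [comp_swap_comp_swap] using this
  refine hlt.not_ge (hmin _ ⟨K.add_mem hzK (hinv i j hij z hzK), x ∘ Equiv.swap i j, ?_⟩)
  have hwx := (wt_comp_equiv x (Equiv.swap i j)).trans hx'.1
  rw [hsupp, hW _ hwx, comp_swap_comp_swap, if_pos (by simp [hxi, hxj])]
  exact ⟨hwx, hx'.2⟩

/-- The action of the shears on `wtKer m (r + 1) / wtKer m r` is irreducible. -/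
theorem eq_wtKer_of_invariant {r : ℕ} {K : Submodule (ZMod 2) (Idx m → ZMod 2)}
    (hK₀ : wtKer m r ≤ K) (hK₁ : K ≤ wtKer m (r + 1))
    (hinv : ∀ (i j : Fin m) (hij : i ≠ j), ∀ z ∈ K, shearEquiv hij z ∈ K) :
    K = wtKer m r ∨ K = wtKer m (r + 1) := by
  classical
  by_cases hne : K ≤ wtKer m r
  · exact Or.inl (le_antisymm hne hK₀)
  refine Or.inr (le_antisymm hK₁ fun w hw => ?_)
  have hall : ∀ x, wt x = r → ∃ z ∈ K, ∀ y, wt y = r → Wfun m z y = if y = x then 1 else 0 := by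
    intro x hx
    obtain ⟨u, ⟨hu, z, hzK, hz⟩, hmin⟩ := Set.exists_min_image
      {u | wt u = r ∧ ∃ z ∈ K, ∀ y, wt y = r → (Wfun m z y ≠ 0 ↔ y = u)}
      (fun u => hammingDist u x) (Set.toFinite _)
      (by
        obtain ⟨z, hz, u, hu, h⟩ := exists_mem_single hK₁ hinv hne
        exact ⟨u, hu, z, hz, h⟩)
    suffices hux : u = x by
      subst hux
      have key : ∀ a : ZMod 2, ∀ P : Prop, ∀ [Decidable P], (a ≠ 0 ↔ P) →
          a = if P then 1 else 0 := by
        intro a P _ h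
        have h01 : ∀ a : ZMod 2, a ≠ 0 → a = 1 := by decide
        split_ifs with hP
        · exact h01 a (h.2 hP)
        · exact not_not.1 fun h' => hP (h.1 h')
      exact ⟨z, hzK, fun y hy => key _ _ (hz y hy)⟩
    by_contra hux
    obtain ⟨i, j, hui, hxi, huj, hxj⟩ := exists_exchange (hu.trans hx.symm) hux
    have hij : i ≠ j := by
      rintro rfl
      exact zero_ne_one (huj.symm.trans hui)
    refine (hmin (u ∘ Equiv.swap i j) ⟨(wt_comp_equiv u _).trans hu, z + shearEquiv hij z,
      K.add_mem hzK (hinv i j hij z hzK), fun y hy => ?_⟩).not_gt ?_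
    · rw [Wfun_add_shearEquiv hij (hK₁ hzK) hy]
      constructor
      · intro h
        have hc : y i = 0 ∧ y j = 1 := by
          by_contra h'
          exact h (if_neg h')
        rw [if_pos hc, hz _ ((wt_comp_equiv y _).trans hy)] at h
        rw [← h, comp_swap_comp_swap]
      · rintro rfl
        rw [if_pos (by simp [hui, huj]), comp_swap_comp_swap]
        exact (hz u hu).2 rfl
    · refine Finset.card_lt_card (Finset.ssubset_iff_of_subset ?_ |>.2 ⟨i, ?_, ?_⟩)
      · intro k
        simp only [Finset.mem_filter, Finset.mem_univ, true_and, Function.comp_apply]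
        by_cases hki : k = i
        · simp [hki, huj, hxi]
        by_cases hkj : k = j
        · simp [hkj, hui, hxj]
        rw [Equiv.swap_apply_of_ne_of_ne hki hkj]
        exact id
      · simp [hui, hxi]
      · simp [huj, hxi]
  choose! Z hZK hZ using hall
  let v : Idx m → ZMod 2 := ∑ x with wt x = r, Wfun m w x • Z x
  have hv : v ∈ K := K.sum_mem fun x hx => K.smul_mem _ (hZK x (Finset.mem_filter.1 hx).2)
  have hvw : w - v ∈ wtKer m r := by
    intro y hy
    rcases hy.eq_or_lt with hy | hy
    · change (Gmat m).mulVecLin (w - v) y = 0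
      simp only [v, map_sub, map_sum, map_smul, Pi.sub_apply, Finset.sum_apply, Pi.smul_apply,
        Matrix.mulVecLin_apply, smul_eq_mul]
      rw [Finset.sum_eq_single_of_mem y (by simp [hy])]
      · change Wfun m w y - Wfun m w y * Wfun m (Z y) y = 0
        simp [hZ y hy.symm y hy.symm]
      · intro x hx hxy
        change Wfun m w x * Wfun m (Z x) y = 0
        rw [hZ x (Finset.mem_filter.1 hx).2 y hy.symm, if_neg hxy.symm, mul_zero]
    · exact (wtKer m (r + 1)).sub_mem hw (hK₁ hv) y hy
  simpa using K.add_mem (hK₀ hvw) hv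

end Transform

section Noise

open FinEntropy

/-- The weight function of `noise m δ`. -/
noncomputable def noiseW (m : ℕ) (δ : ℝ) (z : Idx m → ZMod 2) : ℝ :=
  ∏ x, if z x = 1 then δ else 1 - δ

theorem noiseW_mem_stdSimplex (m : ℕ) {δ : ℝ} (h₀ : 0 ≤ δ) (h₁ : δ ≤ 1) :
    noiseW m δ ∈ stdSimplex ℝ (Idx m → ZMod 2) := by
  refine ⟨fun z => Finset.prod_nonneg fun x _ => ?_, ?_⟩
  · split_ifs <;> linarith
  · unfold noiseW
    rw [← Fintype.prod_sum (fun (_ : Idx m) (c : ZMod 2) => if c = 1 then δ else 1 - δ)]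
    refine Finset.prod_eq_one fun x _ => ?_
    have : ∑ c : ZMod 2, (if c = 1 then δ else 1 - δ) = (1 - δ) + δ := Fin.sum_univ_two _
    rw [this, sub_add_cancel]

theorem isProbabilityMeasure_bern2 {δ : ℝ} (h₀ : 0 ≤ δ) (h₁ : δ ≤ 1) :
    IsProbabilityMeasure (bern2 δ) := by
  refine ⟨?_⟩
  simp [bern2, ← ENNReal.ofReal_add h₀ (sub_nonneg.2 h₁)]

theorem toReal_noise_singleton (m : ℕ) {δ : ℝ} (h₀ : 0 ≤ δ) (h₁ : δ ≤ 1)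
    (z : Idx m → ZMod 2) : (noise m δ {z}).toReal = noiseW m δ z := by
  have := isProbabilityMeasure_bern2 h₀ h₁
  rw [noise, Measure.pi_singleton, ENNReal.toReal_prod, noiseW]
  refine Finset.prod_congr rfl fun x _ => ?_
  have h01 : ∀ a : ZMod 2, a ≠ 1 → a = 0 := by decide
  split_ifs with h
  · simp [bern2, h, h₀]
  · simp [bern2, h01 _ h, h₁]

theorem ent_noise (m : ℕ) {δ : ℝ} (h₀ : 0 ≤ δ) (h₁ : δ ≤ 1) {S : Type*} [Fintype S]
    (X : (Idx m → ZMod 2) → S) :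
    ent (noise m δ) X = shEnt (noiseW m δ) X / Real.log 2 := by
  classical
  have := isProbabilityMeasure_bern2 h₀ h₁
  have hlaw : ∀ s, (noise m δ (X ⁻¹' {s})).toReal = law (noiseW m δ) X s := by
    intro s
    have hs : X ⁻¹' {s} = ((Finset.univ.filter fun z => X z = s : Finset _) : Set _) := by
      ext z
      simp
    have hfin : IsFiniteMeasure (noise m δ) := by
      unfold noise
      infer_instance
    rw [hs, ← sum_measure_singleton, ENNReal.toReal_sum (fun _ _ => measure_ne_top _ _),
      Finset.sum_filter, law]
    exact Finset.sum_congr rfl fun z _ => by rw [toReal_noise_singleton m h₀ h₁]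
  simp only [ent, hlaw, tsum_fintype, Real.logb]
  rw [shEnt_eq_sum_negMulLog, Finset.sum_div, ← Finset.sum_neg_distrib]
  exact Finset.sum_congr rfl fun s _ => by rw [Real.negMulLog]; ring

theorem law_noiseW_shearEquiv (m : ℕ) (δ : ℝ) {i j : Fin m} (hij : i ≠ j) :
    law (noiseW m δ) (shearEquiv hij) = noiseW m δ := by
  have h := law_equiv (noiseW m δ) (shearEquiv hij).toEquiv
  refine h.trans (funext fun z => ?_)
  obtain ⟨w, rfl⟩ := (shearEquiv hij).toEquiv.surjective z
  rw [Equiv.symm_apply_apply]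
  exact (Equiv.prod_comp (shear_involutive hij).toPerm fun x => if w x = 1 then δ else 1 - δ).symm

/-- The weight-`r` part of the transform, as a linear map. -/
def WrLin (m r : ℕ) : (Idx m → ZMod 2) →ₗ[ZMod 2] ({x : Idx m // wt x = r} → ZMod 2) :=
  LinearMap.funLeft (ZMod 2) (ZMod 2) Subtype.val ∘ₗ (Gmat m).mulVecLin

theorem WrLin_apply (m r : ℕ) (z : Idx m → ZMod 2) : WrLin m r z = Wr m r z := rfl

theorem Wgt_sub (m r : ℕ) (z z' : Idx m → ZMod 2) : Wgt m r (z - z') = Wgt m r z - Wgt m r z' := by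
  ext x
  simp only [Wgt, Wfun, Matrix.mulVec_sub, Pi.sub_apply]

theorem mem_wtKer_succ_iff {m r : ℕ} {z : Idx m → ZMod 2} :
    z ∈ wtKer m (r + 1) ↔ Wgt m r z = 0 :=
  ⟨fun h => funext fun x => h x.1 x.2, fun h y hy => congr_fun h ⟨y, hy⟩⟩

theorem wtKer_succ_inf_ker (m r : ℕ) :
    wtKer m (r + 1) ⊓ LinearMap.ker (WrLin m r) = wtKer m r := by
  ext z
  simp only [Submodule.mem_inf, LinearMap.mem_ker, mem_wtKer]
  constructor
  · rintro ⟨h, h'⟩ y hy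
    rcases hy.eq_or_lt with hy | hy
    · exact congr_fun h' ⟨y, hy.symm⟩
    · exact h y hy
  · exact fun h => ⟨fun y hy => h y (Nat.le_of_succ_le hy), funext fun x => h x.1 x.2.ge⟩

theorem map_wtKer_succ (m r : ℕ) : (wtKer m (r + 1)).map (WrLin m r) = ⊤ := by
  classical
  rw [eq_top_iff]
  intro u _
  refine ⟨Wfun m fun y => if h : wt y = r then u ⟨y, h⟩ else 0, ?_, ?_⟩
  · intro y hy
    rw [Wfun_Wfun, dif_neg (by omega)]
  · ext x
    rw [WrLin_apply, Wr, Wfun_Wfun, dif_pos x.2]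

theorem min_le_quotient_entropy (m r : ℕ) {δ : ℝ} (h₀ : 0 ≤ δ) (h₁ : δ ≤ 1)
    (U : Submodule (ZMod 2) ({x : Idx m // wt x = r} → ZMod 2)) :
    min (2 * (shEnt (noiseW m δ) (fun z => (Wr m r z, Wgt m r z))
        - shEnt (noiseW m δ) (Wgt m r))) (m.choose r * Real.log 2)
      ≤ 2 * (shEnt (noiseW m δ) (fun z => (U.mkQ (Wr m r z), Wgt m r z))
        - shEnt (noiseW m δ) (Wgt m r)) + Real.log (Nat.card U) := by
  have hp := noiseW_mem_stdSimplex m h₀ h₁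
  set K := wtKer m (r + 1) ⊓ U.comap (WrLin m r) with hK
  have hK₀ : wtKer m r ≤ K := by
    rw [← wtKer_succ_inf_ker]
    exact inf_le_inf_left _ fun z hz => by
      rw [Submodule.mem_comap, LinearMap.mem_ker.1 hz]
      exact U.zero_mem
  have hmin := min_quotEnt_le hp (K₀ := wtKer m r) (K₁ := wtKer m (r + 1))
    {e | ∃ (i j : Fin m) (hij : i ≠ j), e = shearEquiv hij}
    (by
      rintro _ ⟨i, j, hij, rfl⟩
      exact law_noiseW_shearEquiv m δ hij)
    (by
      rintro _ ⟨i, j, hij, rfl⟩ z hz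
      exact shearEquiv_mem_wtKer hij hz)
    (by
      rintro _ ⟨i, j, hij, rfl⟩ z hz
      exact shearEquiv_shearEquiv hij z ▸ shearEquiv_mem_wtKer hij hz)
    (fun L hL₀ hL₁ hinv => eq_wtKer_of_invariant hL₀ hL₁ fun i j hij z hz =>
      hinv _ ⟨i, j, hij, rfl⟩ z hz) hK₀ inf_le_left
  have e₁ : shEnt (noiseW m δ) (wtKer m (r + 1)).mkQ = shEnt (noiseW m δ) (Wgt m r) :=
    shEnt_congr fun a b _ _ => by
      rw [mkQ_eq_mkQ_iff, mem_wtKer_succ_iff, Wgt_sub, sub_eq_zero]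
  have eK : shEnt (noiseW m δ) K.mkQ
      = shEnt (noiseW m δ) (fun z => (U.mkQ (Wr m r z), Wgt m r z)) :=
    shEnt_congr fun a b _ _ => by
      rw [mkQ_eq_mkQ_iff, hK, Submodule.mem_inf, mem_wtKer_succ_iff, Wgt_sub, sub_eq_zero,
        Submodule.mem_comap, map_sub, Prod.mk.injEq, mkQ_eq_mkQ_iff, and_comm]
      rfl
  have e₀ : shEnt (noiseW m δ) (wtKer m r).mkQ
      = shEnt (noiseW m δ) (fun z => (Wr m r z, Wgt m r z)) :=
    shEnt_congr fun a b _ _ => by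
      rw [mkQ_eq_mkQ_iff, ← wtKer_succ_inf_ker, Submodule.mem_inf, mem_wtKer_succ_iff, Wgt_sub,
        sub_eq_zero, LinearMap.mem_ker, map_sub, Prod.mk.injEq, sub_eq_zero, and_comm]
      rfl
  have c₁ := log_card_map_add_log_card_inf_ker (WrLin m r) (wtKer m (r + 1))
  rw [map_wtKer_succ, wtKer_succ_inf_ker] at c₁
  have ctop : Real.log (Nat.card (⊤ : Submodule (ZMod 2) ({x : Idx m // wt x = r} → ZMod 2)))
      = m.choose r * Real.log 2 := by
    rw [log_card_submodule, finrank_top, Module.finrank_fintype_fun_eq_card, card_wt_eq]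
  have cK := log_card_map_add_log_card_inf_ker (WrLin m r) K
  have hKker : K ⊓ LinearMap.ker (WrLin m r) = wtKer m r := by
    refine le_antisymm ?_ (le_inf hK₀ ?_)
    · exact (inf_le_inf_right _ inf_le_left).trans (wtKer_succ_inf_ker m r).le
    · exact (wtKer_succ_inf_ker m r).ge.trans inf_le_right
  have hmap : Real.log (Nat.card (K.map (WrLin m r))) ≤ Real.log (Nat.card U) := by
    rw [log_card_submodule, log_card_submodule]
    refine mul_le_mul_of_nonneg_right ?_ (Real.log_nonneg one_le_two)
    exact_mod_cast Submodule.finrank_mono (Submodule.map_le_iff_le_comap.2 inf_le_right)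
  rw [hKker] at cK
  rw [quotEnt, quotEnt, quotEnt, e₀, e₁, eK] at hmin
  rw [min_le_iff] at hmin ⊢
  rcases hmin with h | h
  · left
    linarith
  · right
    linarith

/-- The joint weight function of `(W_r, W_{>r})`. -/
noncomputable def layerW (m r : ℕ) (δ : ℝ) :
    ({x : Idx m // wt x = r} → ZMod 2) × ({x : Idx m // r < wt x} → ZMod 2) → ℝ :=
  law (noiseW m δ) fun z => (Wr m r z, Wgt m r z)

theorem min_le_condDoubling (m r : ℕ) {δ : ℝ} (h₀ : 0 ≤ δ) (h₁ : δ ≤ 1) :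
    min (shEnt (noiseW m δ) (fun z => (Wr m r z, Wgt m r z)) - shEnt (noiseW m δ) (Wgt m r))
        (m.choose r * Real.log 2 - (shEnt (noiseW m δ) (fun z => (Wr m r z, Wgt m r z))
          - shEnt (noiseW m δ) (Wgt m r)))
      ≤ 104 * condDoubling (layerW m r δ) := by
  obtain ⟨U, hU⟩ := exists_submodule_le_condDoubling
    (law_mem_stdSimplex (noiseW_mem_stdSimplex m h₀ h₁) fun z => (Wr m r z, Wgt m r z))
  have hmin := min_le_quotient_entropy m r h₀ h₁ U
  simp only [shEnt_law] at hU
  change _ ≤ 104 * condDoubling (layerW m r δ) at hU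
  rw [min_le_iff] at hmin ⊢
  rcases hmin with h | h
  · left
    linarith
  · right
    linarith

end Noise

section Recursion

open FinEntropy

/-- Splitting a vector indexed by `Idx (m + 1)` according to the first bit of the index. -/
def splitEquiv (m : ℕ) :
    (Idx (m + 1) → ZMod 2) ≃ (Idx m → ZMod 2) × (Idx m → ZMod 2) where
  toFun z := (fun x => z (Fin.cons 0 x), fun x => z (Fin.cons 1 x))
  invFun w x := if x 0 = 0 then w.1 (Fin.tail x) else w.2 (Fin.tail x)
  left_inv z := by
    have h01 : ∀ a : ZMod 2, a ≠ 0 → a = 1 := by decide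
    ext x
    conv_rhs => rw [← Fin.cons_self_tail x]
    by_cases h : x 0 = 0
    · simp [h]
    · simp [h01 _ h]
  right_inv w := by
    ext x <;> simp

theorem Gmat_cons (m : ℕ) (a b : ZMod 2) (x y : Idx m) :
    Gmat (m + 1) (Fin.cons a x) (Fin.cons b y) = base a b * Gmat m x y := by
  simp [Gmat, Fin.prod_univ_succ]

theorem Wfun_cons (m : ℕ) (z : Idx (m + 1) → ZMod 2) (a : ZMod 2) (x : Idx m) :
    Wfun (m + 1) z (Fin.cons a x) = base a 0 * Wfun m (splitEquiv m z).1 x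
      + base a 1 * Wfun m (splitEquiv m z).2 x := by
  have h : Wfun (m + 1) z (Fin.cons a x)
      = ∑ b : ZMod 2, ∑ y : Idx m, base a b * (Gmat m x y * z (Fin.cons b y)) := by
    rw [← Fintype.sum_prod_type', Wfun, Matrix.mulVec, dotProduct,
      ← Equiv.sum_comp (Fin.consEquiv fun _ => ZMod 2)]
    refine Finset.sum_congr rfl fun w _ => ?_
    change Gmat (m + 1) (Fin.cons a x) (Fin.cons w.1 w.2) * z (Fin.cons w.1 w.2) = _
    rw [Gmat_cons, mul_assoc]
  rw [h]
  simp only [← Finset.mul_sum]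
  exact Fin.sum_univ_two _

theorem Wfun_cons_zero (m : ℕ) (z : Idx (m + 1) → ZMod 2) (x : Idx m) :
    Wfun (m + 1) z (Fin.cons 0 x) = Wfun m (splitEquiv m z).1 x := by
  simp [Wfun_cons, base]

theorem Wfun_cons_one (m : ℕ) (z : Idx (m + 1) → ZMod 2) (x : Idx m) :
    Wfun (m + 1) z (Fin.cons 1 x)
      = Wfun m (splitEquiv m z).1 x + Wfun m (splitEquiv m z).2 x := by
  simp [Wfun_cons, base]

theorem wt_eq_sum {m : ℕ} (x : Idx m) : wt x = ∑ i, if x i = 1 then 1 else 0 := by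
  rw [wt, Finset.card_filter]

theorem wt_cons_zero {m : ℕ} (x : Idx m) : wt (Fin.cons 0 x : Idx (m + 1)) = wt x := by
  rw [wt_eq_sum, wt_eq_sum, Fin.sum_univ_succ]
  simp

theorem wt_cons_one {m : ℕ} (x : Idx m) : wt (Fin.cons 1 x : Idx (m + 1)) = wt x + 1 := by
  rw [wt_eq_sum, wt_eq_sum, Fin.sum_univ_succ]
  simp [add_comm]

theorem law_splitEquiv (m : ℕ) (δ : ℝ) :
    law (noiseW (m + 1) δ) (splitEquiv m) = prodW (noiseW m δ) (noiseW m δ) := by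
  rw [law_equiv]
  ext w
  obtain ⟨z, rfl⟩ := (splitEquiv m).surjective w
  rw [Equiv.symm_apply_apply, noiseW, ← Equiv.prod_comp (Fin.consEquiv fun _ => ZMod 2),
    Fintype.prod_prod_type]
  exact Fin.prod_univ_two _

theorem shEnt_Wgt_succ (m r : ℕ) (δ : ℝ) :
    shEnt (noiseW (m + 1) δ) (Wgt (m + 1) r)
      = shEnt (prodW (layerW m r δ) (layerW m r δ))
        (fun ω => (ω.1.1 + ω.2.1, (ω.1.2, ω.2.2))) := by
  rw [layerW, ← law_prodW_map, ← law_splitEquiv, law_law, shEnt_law]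
  refine shEnt_congr fun z z' _ _ => ?_
  simp only [Prod.mk.injEq, funext_iff, Subtype.forall, Wgt, Wr, Pi.add_apply]
  constructor
  · intro h
    have h0 : ∀ x, r < wt x → _ := fun x hx => h (Fin.cons 0 x) (by rwa [wt_cons_zero])
    have h1 : ∀ x, r ≤ wt x → _ := fun x hx => h (Fin.cons 1 x) (by rw [wt_cons_one]; omega)
    simp only [Wfun_cons_zero] at h0
    simp only [Wfun_cons_one] at h1
    refine ⟨fun x hx => h1 x hx.ge, h0, fun x hx => ?_⟩
    have := h1 x hx.le
    rwa [h0 x hx, add_right_inj] at this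
  · rintro ⟨hr, h0, h1⟩ y
    induction y using Fin.consCases with
    | cons a x =>
      obtain rfl | rfl : a = 0 ∨ a = 1 := by revert a; decide
      · rw [wt_cons_zero, Wfun_cons_zero, Wfun_cons_zero]
        exact h0 x
      · rw [wt_cons_one, Wfun_cons_one, Wfun_cons_one]
        intro hx
        rcases (Nat.lt_succ_iff.1 hx).eq_or_lt with hx | hx
        · exact hr x hx.symm
        · rw [h0 x hx, h1 x hx]

theorem shEnt_Wle_Wgt (m r : ℕ) (δ : ℝ) :
    shEnt (noiseW m δ) (fun z => (Wle m r z, Wgt m r z)) = shEnt (noiseW m δ) (fun z => z) := by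
  refine shEnt_congr fun z z' _ _ => ⟨fun h => ?_, fun h => by rw [h]⟩
  rw [Prod.mk.injEq] at h
  rw [← Wfun_Wfun z, ← Wfun_Wfun z']
  congr 1
  ext x
  rcases le_or_gt (wt x) r with hx | hx
  · exact congr_fun h.1 ⟨x, hx⟩
  · exact congr_fun h.2 ⟨x, hx⟩

theorem shEnt_noiseW_succ (m : ℕ) {δ : ℝ} (h₀ : 0 ≤ δ) (h₁ : δ ≤ 1) :
    shEnt (noiseW (m + 1) δ) (fun z => z) = 2 * shEnt (noiseW m δ) (fun z => z) := by
  have hp := noiseW_mem_stdSimplex m h₀ h₁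
  rw [two_mul, ← shEnt_prodW_map hp hp (fun z => z) (fun z => z), ← law_splitEquiv, shEnt_law]
  exact shEnt_congr fun z z' _ _ => (splitEquiv m).injective.eq_iff.symm

theorem shEnt_Wgt_pred (m : ℕ) {r : ℕ} (hr : 1 ≤ r) (δ : ℝ) :
    shEnt (noiseW m δ) (Wgt m (r - 1)) = shEnt (noiseW m δ) (fun z => (Wr m r z, Wgt m r z)) := by
  refine shEnt_congr fun z z' _ _ => ?_
  simp only [Prod.mk.injEq, funext_iff, Subtype.forall, Wgt, Wr]
  constructor
  · exact fun h => ⟨fun x hx => h x (by omega), fun x hx => h x (by omega)⟩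
  · rintro ⟨h, h'⟩ x hx
    rcases (Nat.le_of_pred_lt hx).eq_or_lt with hx | hx
    · exact h x hx.symm
    · exact h' x hx

end Recursion

/-- the recurrence bound
`H(W^{(m+1)}_{≤r} | W^{(m+1)}_{>r}) ≤ f_{m,≤r} + f_{m,≤r-1} - (1/140)·min(f_{m,r}, binom(m,r) - f_{m,r})`,
where `f_{m,r} = H(W^{(m)}_r | W^{(m)}_{>r})` and `f_{m,≤r} = H(W^{(m)}_{≤r} | W^{(m)}_{>r})`. -/
theorem stmt10 (δ : ℝ) (hδ : δ ∈ Set.Ioo 0 (1/2 : ℝ)) (m r : ℕ) (hm : 1 ≤ m)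
    (hr : 1 ≤ r) (hrm : r ≤ m) :
    condEnt (noise (m + 1) δ) (Wle (m + 1) r) (Wgt (m + 1) r)
      ≤ condEnt (noise m δ) (Wle m r) (Wgt m r)
        + condEnt (noise m δ) (Wle m (r - 1)) (Wgt m (r - 1))
        - (1 / 140) * min (condEnt (noise m δ) (Wr m r) (Wgt m r))
            ((m.choose r : ℝ) - condEnt (noise m δ) (Wr m r) (Wgt m r)) := by
  have h₀ := hδ.1.le
  have h₁ : δ ≤ 1 := hδ.2.le.trans (by norm_num)
  have hp := noiseW_mem_stdSimplex m h₀ h₁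
  have hlog : 0 < Real.log 2 := Real.log_pos one_lt_two
  have hd := FinEntropy.condDoubling_nonneg (FinEntropy.law_mem_stdSimplex hp
    fun z => (Wr m r z, Wgt m r z))
  change 0 ≤ FinEntropy.condDoubling (layerW m r δ) at hd
  have hmin := min_le_condDoubling m r h₀ h₁
  have hD : FinEntropy.condDoubling (layerW m r δ)
      = FinEntropy.shEnt (noiseW (m + 1) δ) (Wgt (m + 1) r)
        - FinEntropy.shEnt (noiseW m δ) (Wgt m r)
        - FinEntropy.shEnt (noiseW m δ) (fun z => (Wr m r z, Wgt m r z)) := by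
    rw [FinEntropy.condDoubling, ← shEnt_Wgt_succ, layerW, FinEntropy.shEnt_law,
      FinEntropy.shEnt_law]
    ring
  simp only [condEnt, ent_noise _ h₀ h₁, shEnt_Wle_Wgt, shEnt_noiseW_succ m h₀ h₁,
    shEnt_Wgt_pred m hr]
  rw [hD] at hmin hd
  generalize FinEntropy.shEnt (noiseW (m + 1) δ) (Wgt (m + 1) r) = D at *
  generalize FinEntropy.shEnt (noiseW m δ) (Wgt m r) = Y at *
  generalize FinEntropy.shEnt (noiseW m δ) (fun z => (Wr m r z, Wgt m r z)) = XY at *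
  generalize FinEntropy.shEnt (noiseW m δ) (fun z => z) = Z
  have hscale : min (XY / Real.log 2 - Y / Real.log 2)
      (m.choose r - (XY / Real.log 2 - Y / Real.log 2))
      = min (XY - Y) (m.choose r * Real.log 2 - (XY - Y)) / Real.log 2 := by
    rw [← min_div_div_right hlog.le, sub_div, sub_div, sub_div, mul_div_cancel_right₀ _ hlog.ne']
  rw [hscale]
  have hfin : 1 / 140 * min (XY - Y) (m.choose r * Real.log 2 - (XY - Y)) ≤ D - Y - XY := by
    linarith
  have := div_le_div_of_nonneg_right hfin hlog.le
  rw [mul_div_assoc] at this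
  linear_combination this
end

section
/- With the notation below, for every ε ∈ (0,1), letting r(m,ε) := max{ r : f_{m,r}/binom(m,r) < 1−ε }, one has binom(m, ≤ r(m,ε)) / 2^m ≥ 1 − H(δ)/(1−ε), where binom(m,≤r) := ∑_{i=0}^{r} binom(m,i) and H(δ) := −δ log₂ δ − (1−δ) log₂(1−δ). -/
open MeasureTheory

/-- The binary entropy function `H(δ) = -δ log₂ δ - (1-δ) log₂ (1-δ)`. -/
noncomputable def Hbin (δ : ℝ) : ℝ :=
  -(δ * Real.logb 2 δ) - (1 - δ) * Real.logb 2 (1 - δ)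

/-- `binom(m, ≤ r) = ∑_{i=0}^{r} binom(m,i)`. -/
def binomLe (m r : ℕ) : ℕ := ∑ i ∈ Finset.range (r + 1), m.choose i

/-- Entropy does not increase under post-composition with a function. -/
theorem ent_comp_le {Ω S T : Type*} [MeasurableSpace Ω] [DiscreteMeasurableSpace Ω]
    (μ : Measure Ω) [IsFiniteMeasure μ] [Fintype S] [Fintype T] (X : Ω → S) (φ : S → T) :
    ent μ (fun ω => φ (X ω)) ≤ ent μ X := by
  classical
  have fiber_sum : ∀ t, (μ ((fun ω => φ (X ω)) ⁻¹' {t})).toReal =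
      ∑ s with φ s = t, (μ (X ⁻¹' {s})).toReal := by
    intro t
    have h := sum_measureReal_preimage_singleton (μ := μ) (f := X)
      (Finset.univ.filter fun s => φ s = t) (fun _ _ => MeasurableSet.of_discrete)
    simp only [Measure.real] at h
    rw [h]
    congr 2
    ext ω
    simp
  unfold ent
  rw [tsum_fintype, tsum_fintype, neg_le_neg_iff,
    ← Finset.sum_fiberwise Finset.univ φ
      (fun s => (μ (X ⁻¹' {s})).toReal * Real.logb 2 (μ (X ⁻¹' {s})).toReal)]
  refine Finset.sum_le_sum fun t _ => ?_
  rw [fiber_sum t, Finset.sum_mul]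
  refine Finset.sum_le_sum fun s hs => ?_
  rcases (ENNReal.toReal_nonneg (a := μ (X ⁻¹' {s}))).eq_or_lt with h0 | hpos
  · simp [← h0]
  · refine mul_le_mul_of_nonneg_left ?_ hpos.le
    refine Real.logb_le_logb_of_le one_lt_two hpos ?_
    exact Finset.single_le_sum (f := fun s => (μ (X ⁻¹' {s})).toReal)
      (fun _ _ => ENNReal.toReal_nonneg) hs

theorem ent_nonneg {Ω S : Type*} [MeasurableSpace Ω] (μ : Measure Ω) [IsProbabilityMeasure μ]
    [Fintype S] (X : Ω → S) : 0 ≤ ent μ X := by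
  unfold ent
  rw [tsum_fintype, ← Finset.sum_neg_distrib]
  refine Finset.sum_nonneg fun s _ => neg_nonneg.2 ?_
  exact mul_nonpos_of_nonneg_of_nonpos ENNReal.toReal_nonneg
    (Real.logb_nonpos one_lt_two ENNReal.toReal_nonneg measureReal_le_one)

theorem condEnt_nonneg {Ω S T : Type*} [MeasurableSpace Ω] [DiscreteMeasurableSpace Ω]
    (μ : Measure Ω) [IsFiniteMeasure μ] [Fintype S] [Fintype T] (X : Ω → S) (Y : Ω → T) :
    0 ≤ condEnt μ X Y :=
  sub_nonneg.2 (ent_comp_le μ (fun ω => (X ω, Y ω)) Prod.snd)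

/-- Weighting a product distribution by an additive functional. -/
theorem sum_prod_mul_sum {ι α : Type*} [Fintype ι] [DecidableEq ι] [Fintype α]
    (b g : α → ℝ) (hb : ∑ a, b a = 1) :
    ∑ z : ι → α, (∏ y, b (z y)) * ∑ x, g (z x) = Fintype.card ι * ∑ a, b a * g a := by
  simp_rw [Finset.mul_sum]
  rw [Finset.sum_comm]
  have coord : ∀ x : ι, ∑ z : ι → α, (∏ y, b (z y)) * g (z x) = ∑ a, b a * g a := by
    intro x
    have h := Fintype.prod_sum (fun (y : ι) (a : α) => b a * if y = x then g a else 1)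
    have factor : ∀ z : ι → α, (∏ y, b (z y)) * g (z x) =
        ∏ y, b (z y) * if y = x then g (z y) else 1 := by
      intro z
      rw [Finset.prod_mul_distrib, Finset.prod_ite_eq' Finset.univ x (fun y => g (z y))]
      simp
    simp_rw [factor]
    rw [← h, Finset.prod_eq_single x]
    · simp
    · intro y _ hy
      simp [hy, hb]
    · simp
  simp_rw [coord]
  simp [Finset.mul_sum]

theorem isProbabilityMeasure_bern2_s11 {δ : ℝ} (h0 : 0 ≤ δ) (h1 : δ ≤ 1) :
    IsProbabilityMeasure (bern2 δ) := by
  constructor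
  simp only [bern2, Measure.add_apply, Measure.smul_apply, measure_univ, smul_eq_mul, mul_one]
  rw [← ENNReal.ofReal_add h0 (by linarith)]
  simp

theorem bern2_real_one {δ : ℝ} (h0 : 0 ≤ δ) : (bern2 δ).real {1} = δ := by
  simp [bern2, Measure.real, h0]

theorem bern2_real_zero {δ : ℝ} (h1 : δ ≤ 1) : (bern2 δ).real {0} = 1 - δ := by
  simp [bern2, Measure.real, h1]

/-- The entropy of `2 ^ m` i.i.d. Bernoulli bits. -/
theorem ent_noise_s11 (m : ℕ) {δ : ℝ} (h0 : 0 < δ) (h1 : δ < 1) :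
    ent (noise m δ) (fun z => z) = 2 ^ m * Hbin δ := by
  have := isProbabilityMeasure_bern2_s11 h0.le h1.le
  have sum_two : ∀ g : ZMod 2 → ℝ, ∑ a, g a = g 0 + g 1 := fun g => Fin.sum_univ_two g
  have pos : ∀ a : ZMod 2, 0 < (bern2 δ).real {a} := by
    intro a
    fin_cases a
    · exact (bern2_real_zero h1.le).symm ▸ sub_pos.2 h1
    · exact (bern2_real_one h0.le).symm ▸ h0
  have mass : ∀ z : Idx m → ZMod 2, (noise m δ ((fun z => z) ⁻¹' {z})).toReal =
      ∏ x, (bern2 δ).real {z x} := by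
    intro z
    rw [Set.preimage_id', noise, Measure.pi_singleton, ENNReal.toReal_prod]
    rfl
  have log_mass : ∀ z : Idx m → ZMod 2, Real.logb 2 (∏ x, (bern2 δ).real {z x}) =
      ∑ x, Real.logb 2 ((bern2 δ).real {z x}) :=
    fun z => Real.logb_prod _ _ fun x _ => (pos (z x)).ne'
  unfold ent
  rw [tsum_fintype]
  simp_rw [mass, log_mass]
  rw [sum_prod_mul_sum (fun a => (bern2 δ).real {a})
    (fun a => Real.logb 2 ((bern2 δ).real {a}))
    (by rw [sum_two, bern2_real_zero h1.le, bern2_real_one h0.le]; ring),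
    sum_two, bern2_real_zero h1.le, bern2_real_one h0.le]
  simp only [Fintype.card_fun, ZMod.card, Fintype.card_fin, Nat.cast_pow, Nat.cast_ofNat, Hbin]
  ring

/-- The coordinates of `W` whose index has Hamming weight at least `k`. -/
def Wge (m k : ℕ) (z : Idx m → ZMod 2) : {x : Idx m // k ≤ wt x} → ZMod 2 :=
  fun x => Wfun m z x.val

theorem condEnt_Wr_le (m r : ℕ) (μ : Measure (Idx m → ZMod 2)) [IsFiniteMeasure μ] :
    condEnt μ (Wr m r) (Wgt m r) ≤ ent μ (Wge m r) - ent μ (Wge m (r + 1)) :=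
  sub_le_sub_right (ent_comp_le μ (Wge m r) fun w =>
    ((fun x => w ⟨x.1, x.2.ge⟩, fun x => w ⟨x.1, x.2.le⟩) :
      ({x : Idx m // wt x = r} → ZMod 2) × ({x : Idx m // r < wt x} → ZMod 2))) _

theorem sum_condEnt_le (m : ℕ) {δ : ℝ} (h0 : 0 < δ) (h1 : δ < 1) :
    ∑ r ∈ Finset.range (m + 1), condEnt (noise m δ) (Wr m r) (Wgt m r) ≤ 2 ^ m * Hbin δ := by
  have := isProbabilityMeasure_bern2_s11 h0.le h1.le
  have : IsProbabilityMeasure (noise m δ) := by unfold noise; infer_instance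
  calc ∑ r ∈ Finset.range (m + 1), condEnt (noise m δ) (Wr m r) (Wgt m r)
      ≤ ∑ r ∈ Finset.range (m + 1),
          (ent (noise m δ) (Wge m r) - ent (noise m δ) (Wge m (r + 1))) :=
        Finset.sum_le_sum fun r _ => condEnt_Wr_le m r _
    _ = ent (noise m δ) (Wge m 0) - ent (noise m δ) (Wge m (m + 1)) :=
        Finset.sum_range_sub' (fun k => ent (noise m δ) (Wge m k)) _
    _ ≤ ent (noise m δ) (Wge m 0) := sub_le_self _ (ent_nonneg _ _)
    _ ≤ ent (noise m δ) (fun z => z) := ent_comp_le _ (fun z => z) (Wge m 0)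
    _ = 2 ^ m * Hbin δ := ent_noise_s11 m h0 h1

/-- with `r(m,ε) := max{r ≤ m : f_{m,r}/binom(m,r) < 1 - ε}` (where
`f_{m,r} = H(W^{(m)}_r | W^{(m)}_{>r})`), one has
`binom(m, ≤ r(m,ε)) / 2^m ≥ 1 - H(δ)/(1-ε)`. -/
theorem stmt11 (δ : ℝ) (hδ : δ ∈ Set.Ioo 0 (1/2 : ℝ)) (ε : ℝ) (hε : ε ∈ Set.Ioo 0 1) (m : ℕ) :
    (binomLe m (sSup {r : ℕ | r ≤ m ∧
        condEnt (noise m δ) (Wr m r) (Wgt m r) / (m.choose r : ℝ) < 1 - ε}) : ℝ) / 2 ^ m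
      ≥ 1 - Hbin δ / (1 - ε) := by
  obtain ⟨h0, hhalf⟩ := hδ
  have h1 : δ < 1 := by linarith
  have hε1 : 0 < 1 - ε := sub_pos.2 hε.2
  have := isProbabilityMeasure_bern2_s11 h0.le h1.le
  have : IsProbabilityMeasure (noise m δ) := by unfold noise; infer_instance
  set A := {r : ℕ | r ≤ m ∧
    condEnt (noise m δ) (Wr m r) (Wgt m r) / (m.choose r : ℝ) < 1 - ε}
  have bdd : BddAbove A := ⟨m, fun r hr => hr.1⟩
  have R_le : sSup A ≤ m := by
    rcases A.eq_empty_or_nonempty with h | h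
    · simp [h]
    · exact csSup_le h fun r hr => hr.1
  have large : ∀ r ∈ Finset.Ico (sSup A + 1) (m + 1),
      (1 - ε) * (m.choose r : ℝ) ≤ condEnt (noise m δ) (Wr m r) (Wgt m r) := by
    intro r hr
    rw [Finset.mem_Ico] at hr
    have notMem : r ∉ A := fun h => absurd (le_csSup bdd h) (by omega)
    have choose_pos : (0 : ℝ) < m.choose r := by
      exact_mod_cast Nat.choose_pos (by omega : r ≤ m)
    rw [← le_div_iff₀ choose_pos]
    by_contra! h
    exact notMem ⟨by omega, h⟩
  have tail_le : (1 - ε) * ∑ r ∈ Finset.Ico (sSup A + 1) (m + 1), (m.choose r : ℝ) ≤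
      2 ^ m * Hbin δ := by
    rw [Finset.mul_sum]
    refine (Finset.sum_le_sum large).trans (le_trans ?_ (sum_condEnt_le m h0 h1))
    refine Finset.sum_le_sum_of_subset_of_nonneg ?_ fun r _ _ => condEnt_nonneg _ _ _
    intro r hr
    exact Finset.mem_range.2 (Finset.mem_Ico.1 hr).2
  have total : (binomLe m (sSup A) : ℝ) +
      ∑ r ∈ Finset.Ico (sSup A + 1) (m + 1), (m.choose r : ℝ) = 2 ^ m := by
    rw [binomLe, Nat.cast_sum, Finset.sum_range_add_sum_Ico _ (by omega)]
    exact_mod_cast Nat.sum_range_choose m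
  rw [ge_iff_le, le_div_iff₀ (by positivity), sub_mul, one_mul, sub_le_iff_le_add, ← total,
    add_le_add_iff_left, total, div_mul_eq_mul_div, le_div_iff₀ hε1]
  linarith
end
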